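/- Let d ≥ 2, α ∈ (1,2), and let μ be a nondegenerate α-stable distribution on ℝ^d with no shift and characteristic exponent Φ_μ(z) = |z|^α V(u_z). Then the density g of μ satisfies, for every x ∈ ℝ^d, g(x) = (2^{1−d}/(π^{d/2} α)) Σ_{n=0}^∞ Γ((n+d)/α) (|x|/2)^n Σ_{m=0}^{⌊n/2⌋} (−1)^m S_{n−2m, −(n+d)/α}(u_x) / (m! Γ(n−m+d/2)), where S_{j,p} = (−i)^j proj_j(V^p); the series converges absolutely, uniformly on {x : |x| ≤ M} for every M > 0. Moreover, if X ∼ μ, then |X| has density g_{|X|}(r) = (1/(π^{d/2} α)) Σ_{n=0}^∞ ((−1)^n Γ((2n+d)/α)/(n! Γ(n+d/2))) (r/2)^{2n+d−1} ∫_{S^{d−1}} V^{−(2n+d)/α} dω. -/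

import Mathlib

open MeasureTheory Real Filter Topology
open scoped RealInnerProductSpace ENNReal NNReal

noncomputable section

namespace StablePaper

abbrev Ed (d : ℕ) : Type := EuclideanSpace ℝ (Fin d)

abbrev Sph (d : ℕ) := Metric.sphere (0 : Ed d) 1

/-- The surface measure `ω` on the unit sphere `S^{d-1}`. -/
def ωd (d : ℕ) : Measure (Sph d) := (volume : Measure (Ed d)).toSphere

/-- `u_z = z/|z|` for `z ≠ 0`, as a point of the unit sphere. -/
def unitize {d : ℕ} (z : Ed d) (hz : z ≠ 0) : Sph d :=
  ⟨‖z‖⁻¹ • z, by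
    rw [mem_sphere_iff_norm, sub_zero, norm_smul, norm_inv, norm_norm,
      inv_mul_cancel₀ (norm_ne_zero_iff.mpr hz)]⟩

/-- Negation on the unit sphere. -/
def negS {d : ℕ} (u : Sph d) : Sph d :=
  ⟨-(u : Ed d), by
    rw [mem_sphere_iff_norm, sub_zero, norm_neg]
    have := u.2
    rwa [mem_sphere_iff_norm, sub_zero] at this⟩

/-- Rising factorial (Pochhammer symbol) `(b)_n`. -/
def risingFactorial (b : ℝ) (n : ℕ) : ℝ := ∏ i ∈ Finset.range n, (b + i)

/-- The Gegenbauer polynomial `C_j^b(t)` (for `b > 0`), via its explicit sum formula. -/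
def gegenbauer (b : ℝ) (j : ℕ) (t : ℝ) : ℝ :=
  ∑ m ∈ Finset.range (j / 2 + 1),
    (-1 : ℝ) ^ m * 2 ^ (j - 2 * m) * risingFactorial b (j - m) /
      ((Nat.factorial m : ℝ) * (Nat.factorial (j - 2 * m) : ℝ)) * t ^ (j - 2 * m)

/-- The normalized (ultraspherical) polynomial `C̃_j^b(t) = C_j^b(t)/C_j^b(1)`;
for `b = 0` it is the Chebyshev polynomial `T_j`. -/
def gegenbauerN (b : ℝ) (j : ℕ) (t : ℝ) : ℝ :=
  if b = 0 then (Polynomial.Chebyshev.T ℝ (j : ℤ)).eval t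
  else gegenbauer b j t / gegenbauer b j 1

/-- `c_{j,d} = dim ℋ_{j,d}`. -/
def cdim (d j : ℕ) : ℕ :=
  if j = 0 then 1 else Nat.choose (j + d - 2) j + Nat.choose (j + d - 3) (j - 1)

/-- The surface area `A(S^{d-1}) = 2 π^{d/2} / Γ(d/2)`. -/
def sphereArea (d : ℕ) : ℝ := 2 * Real.pi ^ ((d : ℝ) / 2) / Real.Gamma ((d : ℝ) / 2)

/-- Projection onto spherical harmonics of degree `j` (real-valued version):
`(proj_j f)(u) = (c_{j,d}/A(S^{d-1})) ∫ C̃_j^{(d-2)/2}(⟨u,v⟩) f(v) ω(dv)`. -/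
def projR (d j : ℕ) (f : Sph d → ℝ) (u : Sph d) : ℝ :=
  (cdim d j : ℝ) / sphereArea d *
    ∫ v, gegenbauerN (((d : ℝ) - 2) / 2) j ⟪(u : Ed d), (v : Ed d)⟫ * f v ∂(ωd d)

/-- Projection onto spherical harmonics of degree `j` (complex-valued version). -/
def projC (d j : ℕ) (f : Sph d → ℂ) (u : Sph d) : ℂ :=
  ((cdim d j : ℂ) / (sphereArea d : ℂ)) *
    ∫ v, (gegenbauerN (((d : ℝ) - 2) / 2) j ⟪(u : Ed d), (v : Ed d)⟫ : ℂ) * f v ∂(ωd d)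

/-- The coefficients `w_j(α)`. -/
def w (d : ℕ) (α : ℝ) (j : ℕ) : ℝ :=
  Real.pi ^ ((d : ℝ) / 2) * Real.Gamma (α + 1) /
    (2 ^ (α - 1) * Real.Gamma (((j : ℝ) + α + d) / 2) * Real.Gamma ((α - j) / 2 + 1))

/-- The characteristic exponent of an `α`-stable distribution (`α ≠ 1`) with
spectral spherical measure `Λ`. -/
def charExp (d : ℕ) (α : ℝ) (Λ : Measure (Sph d)) (z : Ed d) : ℂ :=
  ∫ v, (|⟪z, (v : Ed d)⟫| ^ α : ℝ) *
      (1 - Complex.I * (Real.tan (Real.pi * α / 2) : ℂ) *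
        (Real.sign ⟪z, (v : Ed d)⟫ : ℂ)) ∂Λ

/-- `V(u)`, so that `Φ_μ(z) = |z|^α V(u_z)`. -/
def Vfun (d : ℕ) (α : ℝ) (Λ : Measure (Sph d)) (u : Sph d) : ℂ :=
  charExp d α Λ (u : Ed d)

/-- The characteristic exponent of a `1`-stable distribution with
spectral spherical measure `Λ`. -/
def charExp1 (d : ℕ) (Λ : Measure (Sph d)) (z : Ed d) : ℂ :=
  ∫ v, ((|⟪z, (v : Ed d)⟫| : ℝ) : ℂ) +
      Complex.I * ((2 / Real.pi * (⟪z, (v : Ed d)⟫ *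
        Real.log |⟪z, (v : Ed d)⟫|) : ℝ) : ℂ) ∂Λ

/-- The spectral spherical measure `λ(dv) = P(v) ω(dv)`. -/
def specMeasure (d : ℕ) (P : Sph d → ℝ) : Measure (Sph d) :=
  (ωd d).withDensity (fun v => ENNReal.ofReal (P v))

/-- `μ` has Fourier transform `exp (-Φ)` where `Φ` is the `α`-stable characteristic
exponent with spectral spherical measure `Λ` (case `α ≠ 1`). -/
def IsStableChar (d : ℕ) (α : ℝ) (Λ : Measure (Sph d)) (μ : Measure (Ed d)) : Prop :=
  ∀ z : Ed d, ∫ x, Complex.exp (Complex.I * (⟪z, x⟫ : ℂ)) ∂μ =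
    Complex.exp (- charExp d α Λ z)

/-- `μ` has Fourier transform `exp (-Φ)` where `Φ` is the `1`-stable characteristic
exponent with spectral spherical measure `Λ`. -/
def IsStableChar1 (d : ℕ) (Λ : Measure (Sph d)) (μ : Measure (Ed d)) : Prop :=
  ∀ z : Ed d, ∫ x, Complex.exp (Complex.I * (⟪z, x⟫ : ℂ)) ∂μ =
    Complex.exp (- charExp1 d Λ z)

/-- `μ` is nondegenerate: its support is not contained in any proper affine subspace. -/
def Nondegenerate (d : ℕ) (μ : Measure (Ed d)) : Prop :=
  ∀ (a : Ed d) (W : Submodule ℝ (Ed d)), W ≠ ⊤ →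
    μ ((fun x => a + x) '' (W : Set (Ed d))) < 1

/-- `P` is the restriction to the sphere of a polynomial on `ℝ^d`. -/
def IsPolyRestriction (d : ℕ) (P : Sph d → ℝ) : Prop :=
  ∃ p : MvPolynomial (Fin d) ℝ,
    ∀ u : Sph d, P u = MvPolynomial.eval (fun i => (u : Ed d) i) p

/-- `P` is the restriction to the sphere of a polynomial of degree at most `q`. -/
def IsPolyRestrictionDeg (d q : ℕ) (P : Sph d → ℝ) : Prop :=
  ∃ p : MvPolynomial (Fin d) ℝ, p.totalDegree ≤ q ∧
    ∀ u : Sph d, P u = MvPolynomial.eval (fun i => (u : Ed d) i) p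

/-- `f` is a spherical harmonic of degree `j`: the restriction to the sphere of a
homogeneous harmonic polynomial of degree `j`. -/
def IsSphericalHarmonicC (d j : ℕ) (f : Sph d → ℂ) : Prop :=
  ∃ p : MvPolynomial (Fin d) ℂ, p.IsHomogeneous j ∧
    (∑ i : Fin d, MvPolynomial.pderiv i (MvPolynomial.pderiv i p)) = 0 ∧
    ∀ u : Sph d, f u = MvPolynomial.eval (fun i => ((u : Ed d) i : ℂ)) p

/-- `S_{j,k} = (-i)^j proj_j (V^k)`. -/
def SHk (d : ℕ) (α : ℝ) (Λ : Measure (Sph d)) (j k : ℕ) (u : Sph d) : ℂ :=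
  (-Complex.I) ^ j * projC d j (fun v => (Vfun d α Λ v) ^ k) u

/-- `S_{j,p} = (-i)^j proj_j (V^p)` for real exponents `p` (principal branch). -/
def SHp (d : ℕ) (α : ℝ) (Λ : Measure (Sph d)) (j : ℕ) (p : ℝ) (u : Sph d) : ℂ :=
  (-Complex.I) ^ j * projC d j (fun v => (Vfun d α Λ v) ^ (p : ℂ)) u

/-- `g` is the density of the stable distribution with characteristic exponent
`charExp d α Λ`, given by the Fourier inversion formula. -/
def IsDensityOf (d : ℕ) (α : ℝ) (Λ : Measure (Sph d)) (g : Ed d → ℝ) : Prop :=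
  ∀ x : Ed d, (g x : ℂ) =
    (((2 * Real.pi) ^ d)⁻¹ : ℝ) *
      ∫ z : Ed d, Complex.exp (-(Complex.I * (⟪x, z⟫ : ℂ))) *
        Complex.exp (- charExp d α Λ z)

/-- Harmonic numbers `s_n`. -/
def harmonicNum (n : ℕ) : ℝ := ∑ i ∈ Finset.range n, (1 : ℝ) / (i + 1)

def betaD (d : ℕ) : ℝ :=
  if Even d then 1 - Real.log 2 - harmonicNum (d / 2) / 2
  else 1 - harmonicNum (d + 1) + harmonicNum ((d + 1) / 2) / 2

/-- The coefficients `w*_j` (for odd `j`). -/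
def wstar (d j : ℕ) : ℝ :=
  if j = 1 then Real.pi ^ ((d : ℝ) / 2) * betaD d / Real.Gamma ((d : ℝ) / 2 + 1)
  else (-1 : ℝ) ^ ((j - 3) / 2) * Real.pi ^ ((d : ℝ) / 2) *
      Real.Gamma (((j : ℝ) - 1) / 2) / (2 * Real.Gamma (((d : ℝ) + 1 + j) / 2))

/-- The Bessel function of the first kind `J_τ`. -/
def besselJ (τ : ℝ) (x : ℝ) : ℝ :=
  ∑' k : ℕ, (-1 : ℝ) ^ k * (x / 2) ^ (2 * (k : ℝ) + τ) /
    ((Nat.factorial k : ℝ) * Real.Gamma ((k : ℝ) + τ + 1))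

/-- The `(j,k)`-term `((-2^α)^k π^{-d/2} / (k! ρ^{kα+d})) (Γ((j+kα+d)/2)/Γ((j-kα)/2)) S_{j,k}(u)`
of the spherical-harmonic series for the density (`α ∈ (0,1)`), at radius `ρ`. -/
def phiTerm (d : ℕ) (α : ℝ) (Λ : Measure (Sph d)) (j k : ℕ) (ρ : ℝ) (u : Sph d) : ℂ :=
  ((((-((2 : ℝ) ^ α)) ^ k * Real.pi ^ (-(d : ℝ) / 2) /
      ((Nat.factorial k : ℝ) * ρ ^ ((k : ℝ) * α + d)) *
      (Real.Gamma (((j : ℝ) + k * α + d) / 2) /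
        Real.Gamma (((j : ℝ) - k * α) / 2))) : ℝ) : ℂ) * SHk d α Λ j k u

/-- The `k`-th term `((-2^α)^k π^{-d/2} / (k! r^{kα+1})) (Γ((kα+d)/2)/Γ(-kα/2)) ∫ V^k dω`
of the series for the density of `|X|`. -/
def radTerm (d : ℕ) (α : ℝ) (Λ : Measure (Sph d)) (k : ℕ) (r : ℝ) : ℂ :=
  ((((-((2 : ℝ) ^ α)) ^ k * Real.pi ^ (-(d : ℝ) / 2) /
      ((Nat.factorial k : ℝ) * r ^ ((k : ℝ) * α + 1)) *
      (Real.Gamma (((k : ℝ) * α + d) / 2) / Real.Gamma (-((k : ℝ) * α) / 2))) : ℝ) : ℂ) *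
    ∫ u, (Vfun d α Λ u) ^ k ∂(ωd d)

end StablePaper

namespace StablePaper

/-- The `m`-th summand of the Gegenbauer polynomial, extended by zero. -/
def gegenbauerTerm (b : ℝ) (j m : ℕ) (t : ℝ) : ℝ :=
  if 2 * m ≤ j then (-1 : ℝ) ^ m * 2 ^ (j - 2 * m) * risingFactorial b (j - m) /
      ((Nat.factorial m : ℝ) * (Nat.factorial (j - 2 * m) : ℝ)) * t ^ (j - 2 * m) else 0

lemma gegenbauer_eq_sum_gegenbauerTerm (b : ℝ) (j N : ℕ) (hN : j < 2 * N) (t : ℝ) :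
    gegenbauer b j t = ∑ m ∈ Finset.range N, gegenbauerTerm b j m t := by
  unfold gegenbauer
  have hsub : Finset.range (j / 2 + 1) ⊆ Finset.range N := by
    intro m hm
    simp only [Finset.mem_range] at hm ⊢
    omega
  rw [← Finset.sum_subset hsub]
  · refine Finset.sum_congr rfl fun m hm => ?_
    rw [gegenbauerTerm, if_pos]
    simp only [Finset.mem_range] at hm
    omega
  · intro m _ hm
    rw [gegenbauerTerm, if_neg]
    simp only [Finset.mem_range] at hm
    omega

lemma risingFactorial_succ (b : ℝ) (n : ℕ) :
    risingFactorial b (n + 1) = risingFactorial b n * (b + n) := by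
  simp [risingFactorial, Finset.prod_range_succ]

lemma gegenbauerTerm_zero_rec (b : ℝ) (j : ℕ) (t : ℝ) :
    ((j : ℝ) + 1) * gegenbauerTerm b (j + 1) 0 t = 2 * (j + b) * t * gegenbauerTerm b j 0 t := by
  simp only [gegenbauerTerm, mul_zero, zero_le, if_true, Nat.sub_zero, risingFactorial_succ,
    Nat.factorial_succ, pow_succ]
  have := Nat.factorial_ne_zero j
  push_cast
  field_simp
  ring

lemma gegenbauerTerm_succ_rec (b : ℝ) (j m : ℕ) (t : ℝ) :
    ((j : ℝ) + 2) * gegenbauerTerm b (j + 2) (m + 1) t =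
      2 * (j + 1 + b) * t * gegenbauerTerm b (j + 1) (m + 1) t
        - (j + 2 * b) * gegenbauerTerm b j m t := by
  by_cases h : 2 * m ≤ j
  · obtain ⟨e, rfl⟩ := Nat.exists_eq_add_of_le h
    have e1 : 2 * m + e + 2 - 2 * (m + 1) = e := by omega
    have e2 : 2 * m + e + 2 - (m + 1) = (m + e) + 1 := by omega
    have e3 : 2 * m + e - 2 * m = e := by omega
    have e4 : 2 * m + e - m = m + e := by omega
    have e5 : 2 * m + e + 1 - (m + 1) = m + e := by omega
    have hm := Nat.factorial_ne_zero m
    rcases e with _ | e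
    · have h1 : ¬ (2 * (m + 1) ≤ 2 * m + 0 + 1) := by omega
      have h2 : 2 * (m + 1) ≤ 2 * m + 0 + 2 := by omega
      simp only [gegenbauerTerm, if_neg h1, if_pos h2, if_pos h, e1, e2, e3, e4,
        risingFactorial_succ, Nat.factorial_succ]
      push_cast
      field_simp
      ring_nf
    · have h1 : 2 * (m + 1) ≤ 2 * m + (e + 1) + 1 := by omega
      have h2 : 2 * (m + 1) ≤ 2 * m + (e + 1) + 2 := by omega
      have e6 : 2 * m + (e + 1) + 1 - 2 * (m + 1) = e := by omega
      have he := Nat.factorial_ne_zero e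
      simp only [gegenbauerTerm, if_pos h1, if_pos h2, if_pos h, e1, e2, e3, e4, e5, e6,
        risingFactorial_succ, Nat.factorial_succ]
      push_cast
      field_simp
      ring
  · have h1 : ¬ (2 * (m + 1) ≤ j + 1) := by omega
    have h2 : ¬ (2 * (m + 1) ≤ j + 2) := by omega
    simp [gegenbauerTerm, if_neg h1, if_neg h2, if_neg h]

lemma gegenbauer_rec (b : ℝ) (j : ℕ) (t : ℝ) :
    ((j : ℝ) + 2) * gegenbauer b (j + 2) t =
      2 * (j + 1 + b) * t * gegenbauer b (j + 1) t - (j + 2 * b) * gegenbauer b j t := by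
  rw [gegenbauer_eq_sum_gegenbauerTerm b (j + 2) (j + 2) (by omega),
    gegenbauer_eq_sum_gegenbauerTerm b (j + 1) (j + 2) (by omega),
    gegenbauer_eq_sum_gegenbauerTerm b j (j + 1) (by omega),
    Finset.sum_range_succ' _ (j + 1), Finset.sum_range_succ' _ (j + 1), mul_add, mul_add]
  have h0 := gegenbauerTerm_zero_rec b (j + 1) t
  push_cast at h0
  have : ((j : ℝ) + 2) * gegenbauerTerm b (j + 2) 0 t =
      2 * (j + 1 + b) * t * gegenbauerTerm b (j + 1) 0 t := by
    rw [← h0]; ring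
  rw [this, Finset.mul_sum, Finset.mul_sum, Finset.mul_sum,
    Finset.sum_congr rfl fun m _ => gegenbauerTerm_succ_rec b j m t, Finset.sum_sub_distrib]
  ring

lemma gegenbauer_zero (b t : ℝ) : gegenbauer b 0 t = 1 := by
  simp [gegenbauer, risingFactorial]

lemma gegenbauer_one (b t : ℝ) : gegenbauer b 1 t = 2 * b * t := by
  simp [gegenbauer, risingFactorial]

lemma gegenbauer_eval_one (b : ℝ) (j : ℕ) :
    gegenbauer b j 1 = risingFactorial (2 * b) j / (Nat.factorial j : ℝ) := by
  induction j using Nat.twoStepInduction with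
  | zero => simp [gegenbauer_zero, risingFactorial]
  | one => simp [gegenbauer_one, risingFactorial]
  | more j h0 h1 =>
    have h := gegenbauer_rec b j 1
    have f1 : (Nat.factorial (j + 1) : ℝ) = (j + 1) * Nat.factorial j := by
      rw [Nat.factorial_succ]; push_cast; ring
    have f2 : (Nat.factorial (j + 2) : ℝ) = (j + 2) * ((j + 1) * Nat.factorial j) := by
      rw [Nat.factorial_succ, ← f1]; push_cast; ring
    have r1 : risingFactorial (2 * b) (j + 2) =
        risingFactorial (2 * b) j * (2 * b + j) * (2 * b + (j + 1)) := by
      rw [risingFactorial_succ, risingFactorial_succ]; push_cast; ring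
    have hj : (j : ℝ) + 2 ≠ 0 := by positivity
    have hj1 : (j : ℝ) + 1 ≠ 0 := by positivity
    have hf : (Nat.factorial j : ℝ) ≠ 0 := by exact_mod_cast Nat.factorial_ne_zero j
    rw [h0, h1, risingFactorial_succ, f1] at h
    rw [← mul_right_inj' hj, h, r1, f2]
    field_simp
    ring

lemma risingFactorial_natCast_succ (k n : ℕ) :
    risingFactorial ((k : ℝ) + 1) n * (Nat.factorial k : ℝ) = (Nat.factorial (k + n) : ℝ) := by
  induction n with
  | zero => simp [risingFactorial]
  | succ n ih =>
    rw [risingFactorial_succ, ← add_assoc, Nat.factorial_succ, mul_right_comm, ih]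
    push_cast
    ring

/-- The zonal kernel `c_{j,d} C̃_j^{(d-2)/2}`. -/
def zonal (d j : ℕ) (t : ℝ) : ℝ := (cdim d j : ℝ) * gegenbauerN (((d : ℝ) - 2) / 2) j t

lemma zonal_add_three (k j : ℕ) (t : ℝ) :
    zonal (k + 3) j t = (2 * j + k + 1) / (k + 1) * gegenbauer (((k : ℝ) + 1) / 2) j t := by
  have hb : (((k + 3 : ℕ) : ℝ) - 2) / 2 = ((k : ℝ) + 1) / 2 := by push_cast; ring
  have hb0 : ((k : ℝ) + 1) / 2 ≠ 0 := by positivity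
  rw [zonal, hb, gegenbauerN, if_neg hb0, gegenbauer_eval_one]
  have h2 : 2 * (((k : ℝ) + 1) / 2) = (k : ℝ) + 1 := by ring
  have hr := risingFactorial_natCast_succ k j
  have hk := Nat.factorial_ne_zero k
  have hk' : (Nat.factorial k : ℝ) ≠ 0 := by exact_mod_cast hk
  have hkj := Nat.factorial_ne_zero (k + j)
  have hj := Nat.factorial_ne_zero j
  have hrr : risingFactorial ((k : ℝ) + 1) j = (Nat.factorial (k + j) : ℝ) / Nat.factorial k := by
    rw [eq_div_iff hk', hr]
  have hc : (cdim (k + 3) j : ℝ) * Nat.factorial j * Nat.factorial (k + 1) =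
      (2 * j + k + 1) * Nat.factorial (k + j) := by
    rcases j with _ | j
    · simp [cdim, Nat.factorial_succ]
    · have a1 : j + 1 + (k + 3) - 2 = (k + 1) + (j + 1) := by omega
      have a2 : j + 1 + (k + 3) - 3 = (k + 1) + j := by omega
      have a3 : j + 1 - 1 = j := by omega
      rw [cdim, if_neg (by omega), a1, a2, a3]
      have c1 := Nat.add_choose_mul_factorial_mul_factorial (k + 1) (j + 1)
      have c2 := Nat.add_choose_mul_factorial_mul_factorial (k + 1) j
      have c1' : (((k + 1 + (j + 1)).choose (j + 1) : ℕ) : ℝ) * (Nat.factorial (k + 1) : ℝ) *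
        (Nat.factorial (j + 1) : ℝ) = (Nat.factorial (k + 1 + (j + 1)) : ℝ) := by exact_mod_cast c1
      have c2' : (((k + 1 + j).choose j : ℕ) : ℝ) * (Nat.factorial (k + 1) : ℝ) *
        (Nat.factorial j : ℝ) = (Nat.factorial (k + 1 + j) : ℝ) := by exact_mod_cast c2
      have f1 : k + 1 + (j + 1) = (k + (j + 1)) + 1 := by ring
      have f2 : k + 1 + j = k + (j + 1) := by ring
      have f3 : (Nat.factorial (j + 1) : ℝ) = (j + 1) * Nat.factorial j := by
        rw [Nat.factorial_succ]; push_cast; ring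
      have f4 : (Nat.factorial (k + (j + 1) + 1) : ℝ) = (k + j + 2) * Nat.factorial (k + (j + 1)) := by
        rw [Nat.factorial_succ]; push_cast; ring
      rw [f1] at c1' ⊢
      rw [f2] at c2' ⊢
      rw [f4] at c1'
      push_cast
      rw [f3] at c1' ⊢
      linear_combination c1' + (j + 1) * c2'
  rw [h2, hrr]
  rw [Nat.factorial_succ] at hc
  push_cast at hc
  field_simp
  linear_combination gegenbauer (((k : ℝ) + 1) / 2) j t * hc

lemma zonal_zero (d : ℕ) (hd : 2 ≤ d) (t : ℝ) : zonal d 0 t = 1 := by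
  obtain rfl | ⟨k, rfl⟩ : d = 2 ∨ ∃ k, d = k + 3 := by
    rcases Nat.lt_or_ge d 3 with h | h
    · left; omega
    · exact Or.inr ⟨d - 3, by omega⟩
  · simp [zonal, gegenbauerN, cdim]
  · rw [zonal_add_three, gegenbauer_zero]
    have : (k : ℝ) + 1 ≠ 0 := by positivity
    push_cast
    field_simp
    ring

lemma zonal_one (d : ℕ) (hd : 2 ≤ d) (t : ℝ) : zonal d 1 t = d * t := by
  obtain rfl | ⟨k, rfl⟩ : d = 2 ∨ ∃ k, d = k + 3 := by
    rcases Nat.lt_or_ge d 3 with h | h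
    · left; omega
    · exact Or.inr ⟨d - 3, by omega⟩
  · simp [zonal, gegenbauerN, cdim]
  · rw [zonal_add_three, gegenbauer_one]
    have : (k : ℝ) + 1 ≠ 0 := by positivity
    push_cast
    field_simp
    ring

lemma zonal_two (d : ℕ) (hd : 2 ≤ d) (t : ℝ) :
    2 * zonal d 2 t = (d + 2) * (t * zonal d 1 t - 1) := by
  rw [zonal_one d hd]
  obtain rfl | ⟨k, rfl⟩ : d = 2 ∨ ∃ k, d = k + 3 := by
    rcases Nat.lt_or_ge d 3 with h | h
    · left; omega
    · exact Or.inr ⟨d - 3, by omega⟩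
  · simp [zonal, gegenbauerN, cdim, Polynomial.Chebyshev.T_two]
    ring
  · rw [zonal_add_three]
    have h := gegenbauer_rec (((k : ℝ) + 1) / 2) 0 t
    simp only [zero_add, gegenbauer_zero, gegenbauer_one, Nat.cast_zero] at h
    have : (k : ℝ) + 1 ≠ 0 := by positivity
    push_cast
    field_simp
    linear_combination (2 * 2 + k + 1) * h

lemma mul_zonal_add_two (d : ℕ) (hd : 2 ≤ d) (j : ℕ) (t : ℝ) :
    t * zonal d (j + 2) t =
      (j + 3) / (2 * j + 4 + d) * zonal d (j + 3) t +
        (j + d - 1) / (2 * j + d) * zonal d (j + 1) t := by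
  obtain rfl | ⟨k, rfl⟩ : d = 2 ∨ ∃ k, d = k + 3 := by
    rcases Nat.lt_or_ge d 3 with h | h
    · left; omega
    · exact Or.inr ⟨d - 3, by omega⟩
  · have h := congrArg (Polynomial.eval t) (Polynomial.Chebyshev.T_add_two ℝ ((j : ℤ) + 1))
    have e1 : (j : ℤ) + 1 + 2 = ((j + 3 : ℕ) : ℤ) := by push_cast; ring
    have e2 : (j : ℤ) + 1 + 1 = ((j + 2 : ℕ) : ℤ) := by push_cast; ring
    have e3 : (j : ℤ) + 1 = ((j + 1 : ℕ) : ℤ) := by push_cast; ring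
    rw [e1, e2, e3] at h
    simp only [Polynomial.eval_sub, Polynomial.eval_mul, Polynomial.eval_ofNat,
      Polynomial.eval_X] at h
    have hb : (((2 : ℕ) : ℝ) - 2) / 2 = 0 := by norm_num
    have hc : ∀ i : ℕ, cdim 2 (i + 1) = 2 := by
      intro i
      have a1 : i + 1 + 2 - 2 = i + 1 := by omega
      have a2 : i + 1 + 2 - 3 = i := by omega
      simp [cdim, a1, a2]
    simp only [zonal, hb, gegenbauerN, if_true, hc]
    push_cast at h ⊢
    rw [h]
    field_simp
    ring
  · simp only [zonal_add_three]
    have h : (((j + 1 : ℕ) : ℝ) + 2) * gegenbauer (((k : ℝ) + 1) / 2) (j + 3) t =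
        2 * ((j + 1 : ℕ) + 1 + ((k : ℝ) + 1) / 2) * t * gegenbauer (((k : ℝ) + 1) / 2) (j + 2) t
          - ((j + 1 : ℕ) + 2 * (((k : ℝ) + 1) / 2)) * gegenbauer (((k : ℝ) + 1) / 2) (j + 1) t :=
      gegenbauer_rec _ (j + 1) t
    have : (k : ℝ) + 1 ≠ 0 := by positivity
    push_cast at h ⊢
    have h1 : 2 * (j : ℝ) + 4 + (k + 3) ≠ 0 := by positivity
    have h2 : 2 * (j : ℝ) + (k + 3) ≠ 0 := by positivity
    field_simp
    linear_combination (-(2 * (j : ℝ) + 4 + (k + 3)) * (2 * j + (k + 3))) * h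

/-- Coefficient of `zonal d j` in `t * zonal d (j + 1)`. -/
def zonalLower (d j : ℕ) : ℝ := if j = 0 then 1 else (j + d - 2) / (2 * j + d - 2)

lemma mul_zonal_succ (d : ℕ) (hd : 2 ≤ d) (j : ℕ) (t : ℝ) :
    t * zonal d (j + 1) t =
      (j + 2) / (2 * (j + 1) + d) * zonal d (j + 2) t + zonalLower d j * zonal d j t := by
  rcases j with _ | j
  · have h := zonal_two d hd t
    have hd' : (2 : ℝ) + d ≠ 0 := by positivity
    simp only [zonalLower, if_true, zonal_zero d hd, zero_add, Nat.cast_zero, mul_one] at h ⊢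
    field_simp
    linear_combination (-1) * h
  · have h := mul_zonal_add_two d hd j t
    rw [h, zonalLower, if_neg (by omega)]
    push_cast
    ring_nf

def monoTerm (d n m : ℕ) (t : ℝ) : ℝ :=
  if 2 * m ≤ n then zonal d (n - 2 * m) t /
    ((Nat.factorial m : ℝ) * risingFactorial ((d : ℝ) / 2) (n - m)) else 0

def monoTermUp (d n m : ℕ) (t : ℝ) : ℝ :=
  if 2 * m ≤ n then ((n - 2 * m : ℕ) + 1) / (2 * (n - 2 * m : ℕ) + d) *
    (zonal d (n - 2 * m + 1) t /
    ((Nat.factorial m : ℝ) * risingFactorial ((d : ℝ) / 2) (n - m))) else 0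

def monoTermDown (d n m : ℕ) (t : ℝ) : ℝ :=
  if 2 * m + 1 ≤ n then zonalLower d (n - 2 * m - 1) * (zonal d (n - 2 * m - 1) t /
    ((Nat.factorial m : ℝ) * risingFactorial ((d : ℝ) / 2) (n - m))) else 0

lemma mul_monoTerm (d : ℕ) (hd : 2 ≤ d) (n m : ℕ) (t : ℝ) :
    t * monoTerm d n m t = monoTermUp d n m t + monoTermDown d n m t := by
  by_cases h : 2 * m ≤ n
  · obtain ⟨e, rfl⟩ := Nat.exists_eq_add_of_le h
    have e1 : 2 * m + e - 2 * m = e := by omega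
    have hd0 : (d : ℝ) ≠ 0 := by positivity
    rcases e with _ | e
    · rw [monoTerm, monoTermUp, monoTermDown, if_pos h, if_pos h, if_neg (by omega), e1,
        zonal_zero d hd, zonal_one d hd]
      push_cast
      field_simp
      ring
    · rw [monoTerm, monoTermUp, monoTermDown, if_pos h, if_pos h, if_pos (by omega), e1,
        ← mul_div_assoc, mul_zonal_succ d hd]
      have e2 : e + 1 - 1 = e := by omega
      rw [e2]
      push_cast
      ring_nf
  · rw [monoTerm, monoTermUp, monoTermDown, if_neg h, if_neg h, if_neg (by omega)]
    ring

lemma risingFactorial_pos {b : ℝ} (hb : 0 < b) (n : ℕ) : 0 < risingFactorial b n :=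
  Finset.prod_pos fun i _ => by positivity

lemma monoTermUp_zero (d : ℕ) (hd : 2 ≤ d) (n : ℕ) (t : ℝ) :
    2 * monoTermUp d n 0 t = (n + 1) * monoTerm d (n + 1) 0 t := by
  have h := (risingFactorial_pos (show (0 : ℝ) < (d : ℝ) / 2 by positivity) n).ne'
  have hd' : (0 : ℝ) < d := by positivity
  have h2 : 2 * (n : ℝ) + d ≠ 0 := by positivity
  have h3 : (d : ℝ) / 2 + n ≠ 0 := by positivity
  simp only [monoTermUp, monoTerm, mul_zero, zero_le, if_true, Nat.sub_zero, risingFactorial_succ]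
  field_simp
  ring

lemma monoTermUp_add_monoTermDown (d : ℕ) (hd : 2 ≤ d) (n m : ℕ) (t : ℝ) :
    2 * (monoTermUp d n (m + 1) t + monoTermDown d n m t) =
      (n + 1) * monoTerm d (n + 1) (m + 1) t := by
  have hd' : (2 : ℝ) ≤ d := by exact_mod_cast hd
  have hd0 : (0 : ℝ) < d := by positivity
  by_cases h : 2 * m + 1 ≤ n
  · obtain ⟨e, rfl⟩ := Nat.exists_eq_add_of_le h
    have hm := Nat.factorial_ne_zero m
    rcases e with _ | e
    · have e1 : 2 * m + 1 + 0 - 2 * m - 1 = 0 := by omega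
      have e2 : 2 * m + 1 + 0 + 1 - 2 * (m + 1) = 0 := by omega
      have e3 : 2 * m + 1 + 0 + 1 - (m + 1) = m + 1 := by omega
      have e4 : 2 * m + 1 + 0 - m = m + 1 := by omega
      have hr := (risingFactorial_pos (show (0 : ℝ) < (d : ℝ) / 2 by positivity) (m + 1)).ne'
      rw [monoTermUp, monoTermDown, monoTerm, if_neg (by omega), if_pos (by omega),
        if_pos (by omega), e1, e2, e3, e4, zonalLower, if_pos rfl, Nat.factorial_succ]
      push_cast
      field_simp
      ring
    · have e1 : 2 * m + 1 + (e + 1) - 2 * m - 1 = e + 1 := by omega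
      have e2 : 2 * m + 1 + (e + 1) + 1 - 2 * (m + 1) = e + 1 := by omega
      have e3 : 2 * m + 1 + (e + 1) + 1 - (m + 1) = (m + e + 1) + 1 := by omega
      have e4 : 2 * m + 1 + (e + 1) - m = (m + e + 1) + 1 := by omega
      have e5 : 2 * m + 1 + (e + 1) - 2 * (m + 1) = e := by omega
      have e6 : 2 * m + 1 + (e + 1) - (m + 1) = m + e + 1 := by omega
      have hr := (risingFactorial_pos (show (0 : ℝ) < (d : ℝ) / 2 by positivity) (m + e + 1)).ne'
      rw [monoTermUp, monoTermDown, monoTerm, if_pos (by omega), if_pos (by omega),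
        if_pos (by omega), e1, e2, e3, e4, e5, e6, zonalLower, if_neg (by omega),
        Nat.factorial_succ, risingFactorial_succ _ (m + e + 1)]
      have h1 : 2 * (e : ℝ) + d ≠ 0 := by positivity
      have h2 : (d : ℝ) / 2 + (m + e + 1) ≠ 0 := by positivity
      have h2' : (d : ℝ) + 2 * (m + e + 1) ≠ 0 := by positivity
      have h3 : 2 * ((e : ℝ) + 1) + d - 2 = 2 * e + d := by ring
      push_cast
      rw [h3]
      field_simp
      ring
  · rw [monoTermUp, monoTermDown, monoTerm, if_neg h, if_neg (by omega), if_neg (by omega)]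
    ring

lemma pow_eq_sum_monoTerm (d : ℕ) (hd : 2 ≤ d) (t : ℝ) (n : ℕ) :
    ∀ N, n < 2 * N → (2 * t) ^ n = Nat.factorial n * ∑ m ∈ Finset.range N, monoTerm d n m t := by
  induction n with
  | zero =>
    intro N hN
    obtain ⟨N, rfl⟩ : ∃ k, N = k + 1 := ⟨N - 1, by omega⟩
    rw [Finset.sum_range_succ']
    simp [monoTerm, zonal_zero d hd, risingFactorial]
  | succ n ih =>
    intro N hN
    obtain ⟨N, rfl⟩ : ∃ k, N = k + 1 := ⟨N - 1, by omega⟩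
    have hlast : monoTermDown d n N t = 0 := by rw [monoTermDown, if_neg (by omega)]
    rw [pow_succ, ih (N + 1) (by omega), Nat.factorial_succ]
    have : t * ∑ m ∈ Finset.range (N + 1), monoTerm d n m t =
        (n + 1) / 2 * ∑ m ∈ Finset.range (N + 1), monoTerm d (n + 1) m t := by
      have hsum : ∑ m ∈ Finset.range N, (monoTermUp d n (m + 1) t + monoTermDown d n m t) =
          (n + 1) / 2 * ∑ m ∈ Finset.range N, monoTerm d (n + 1) (m + 1) t := by
        rw [Finset.mul_sum]
        refine Finset.sum_congr rfl fun m _ => ?_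
        linear_combination monoTermUp_add_monoTermDown d hd n m t / 2
      rw [Finset.sum_add_distrib] at hsum
      rw [Finset.mul_sum, Finset.sum_congr rfl fun m _ => mul_monoTerm d hd n m t,
        Finset.sum_add_distrib, Finset.sum_range_succ', Finset.sum_range_succ _ N, hlast,
        Finset.sum_range_succ' _ N]
      linear_combination hsum + monoTermUp_zero d hd n t / 2
    push_cast
    linear_combination (2 * (Nat.factorial n : ℝ)) * this

/-- Expansion of a monomial in zonal kernels. -/
lemma pow_eq_sum_zonal (d : ℕ) (hd : 2 ≤ d) (t : ℝ) (n : ℕ) :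
    t ^ n = Nat.factorial n / 2 ^ n * ∑ m ∈ Finset.range (n / 2 + 1),
      Real.Gamma ((d : ℝ) / 2) / ((Nat.factorial m : ℝ) * Real.Gamma ((n : ℝ) - m + (d : ℝ) / 2)) *
        zonal d (n - 2 * m) t := by
  have hd0 : (0 : ℝ) < (d : ℝ) / 2 := by positivity
  have hG : ∀ k : ℕ, Real.Gamma ((k : ℝ) + (d : ℝ) / 2) =
      Real.Gamma ((d : ℝ) / 2) * risingFactorial ((d : ℝ) / 2) k := by
    intro k
    induction k with
    | zero => simp [risingFactorial]
    | succ k ih =>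
      have e : ((k + 1 : ℕ) : ℝ) + (d : ℝ) / 2 = (k + (d : ℝ) / 2) + 1 := by push_cast; ring
      rw [e, Real.Gamma_add_one (by positivity), ih, risingFactorial_succ]
      ring
  have h := pow_eq_sum_monoTerm d hd t n (n / 2 + 1) (by omega)
  rw [mul_pow] at h
  rw [div_mul_eq_mul_div, eq_div_iff (by positivity), mul_comm, h]
  congr 1
  refine Finset.sum_congr rfl fun m hm => ?_
  have hm' : 2 * m ≤ n := by simp only [Finset.mem_range] at hm; omega
  have hc : (n : ℝ) - m = ((n - m : ℕ) : ℝ) := by rw [Nat.cast_sub (by omega)]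
  rw [monoTerm, if_pos hm', hc, hG]
  have := (Real.Gamma_pos_of_pos hd0).ne'
  have := (risingFactorial_pos hd0 (n - m)).ne'
  field_simp

lemma abs_zonal_le (d : ℕ) (hd : 2 ≤ d) (t : ℝ) (ht : |t| ≤ 1) (j : ℕ) :
    |zonal d j t| ≤ (2 * (d : ℝ)) ^ j := by
  have hd' : (2 : ℝ) ≤ d := by exact_mod_cast hd
  induction j using Nat.twoStepInduction with
  | zero => simp [zonal_zero d hd]
  | one =>
    rw [zonal_one d hd, abs_mul, pow_one, Nat.abs_cast]
    nlinarith [abs_nonneg t]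
  | more j h0 h1 =>
    have hrec := mul_zonal_succ d hd j t
    have hl : |zonalLower d j| ≤ 1 := by
      rw [zonalLower]
      split_ifs with hj
      · simp
      · have hj' : (1 : ℝ) ≤ j := by exact_mod_cast Nat.one_le_iff_ne_zero.2 hj
        rw [abs_of_nonneg (div_nonneg (by linarith) (by linarith)), div_le_one (by linarith)]
        linarith
    have hpos : (0 : ℝ) < j + 2 := by positivity
    have hz : zonal d (j + 2) t = (2 * (j + 1) + d) / (j + 2) *
        (t * zonal d (j + 1) t - zonalLower d j * zonal d j t) := by
      rw [hrec]
      field_simp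
      ring
    have hq : (2 * ((j : ℝ) + 1) + d) / (j + 2) ≤ d := by
      rw [div_le_iff₀ hpos]
      nlinarith [(Nat.cast_nonneg j : (0 : ℝ) ≤ j)]
    have hq0 : 0 ≤ (2 * ((j : ℝ) + 1) + d) / (j + 2) := by positivity
    have hin : |t * zonal d (j + 1) t - zonalLower d j * zonal d j t| ≤
        (2 * (d : ℝ)) ^ (j + 1) + (2 * (d : ℝ)) ^ j := by
      refine (abs_sub _ _).trans ?_
      rw [abs_mul, abs_mul]
      gcongr
      · calc |t| * |zonal d (j + 1) t| ≤ 1 * (2 * (d : ℝ)) ^ (j + 1) := by gcongr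
          _ = _ := one_mul _
      · calc |zonalLower d j| * |zonal d j t| ≤ 1 * (2 * (d : ℝ)) ^ j := by gcongr
          _ = _ := one_mul _
    rw [hz, abs_mul, abs_of_nonneg hq0]
    have hp : (2 * (d : ℝ)) ^ j ≤ (2 * (d : ℝ)) ^ (j + 1) :=
      pow_le_pow_right₀ (by linarith) (by omega)
    calc _ ≤ (d : ℝ) * ((2 * (d : ℝ)) ^ (j + 1) + (2 * (d : ℝ)) ^ j) := by gcongr
      _ ≤ (d : ℝ) * ((2 * (d : ℝ)) ^ (j + 1) + (2 * (d : ℝ)) ^ (j + 1)) := by gcongr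
      _ = _ := by ring

/-- The integrand of the characteristic exponent as a function of the inner product. -/
def stableKernel (α s : ℝ) : ℂ :=
  (|s| ^ α : ℝ) * (1 - Complex.I * (Real.tan (Real.pi * α / 2) : ℂ) * (Real.sign s : ℂ))

lemma charExp_eq (d : ℕ) (α : ℝ) (Λ : Measure (Sph d)) (z : Ed d) :
    charExp d α Λ z = ∫ v, stableKernel α ⟪z, (v : Ed d)⟫ ∂Λ := rfl

lemma continuous_stableKernel {α : ℝ} (hα : 0 < α) : Continuous (stableKernel α) := by
  have h1 : Continuous fun s : ℝ => |s| ^ α :=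
    continuous_abs.rpow_const fun _ => Or.inr hα.le
  have h2 : Continuous fun s : ℝ => |s| ^ α * Real.sign s := by
    rw [continuous_iff_continuousAt]
    intro s
    rcases eq_or_ne s 0 with rfl | hs
    · have h0 : Tendsto (fun s : ℝ => |s| ^ α) (𝓝 0) (𝓝 0) := by
        simpa [Real.zero_rpow hα.ne'] using h1.tendsto 0
      have : Tendsto (fun s : ℝ => |s| ^ α * Real.sign s) (𝓝 0) (𝓝 0) := by
        refine squeeze_zero_norm (fun s => ?_) h0
        rw [norm_mul, Real.norm_eq_abs, abs_of_nonneg (Real.rpow_nonneg (abs_nonneg s) α)]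
        refine mul_le_of_le_one_right (Real.rpow_nonneg (abs_nonneg s) α) ?_
        rcases Real.sign_apply_eq s with h | h | h <;> simp [h]
      simpa [ContinuousAt] using this
    · rcases lt_or_gt_of_ne hs with hs | hs
      · refine (h1.mul (continuous_const (y := (-1 : ℝ)))).continuousAt.congr ?_
        filter_upwards [Iio_mem_nhds hs] with x hx
        simp [Real.sign_of_neg hx]
      · refine (h1.mul (continuous_const (y := (1 : ℝ)))).continuousAt.congr ?_
        filter_upwards [Ioi_mem_nhds hs] with x hx
        simp [Real.sign_of_pos hx]
  have : stableKernel α = fun s => ((|s| ^ α : ℝ) : ℂ) -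
      Complex.I * (Real.tan (Real.pi * α / 2) : ℂ) * ((|s| ^ α * Real.sign s : ℝ) : ℂ) := by
    funext s
    rw [stableKernel]
    push_cast
    ring
  rw [this]
  fun_prop

lemma stableKernel_mul {α : ℝ} (hα : 0 < α) {t : ℝ} (ht : 0 ≤ t) (s : ℝ) :
    stableKernel α (t * s) = ((t ^ α : ℝ) : ℂ) * stableKernel α s := by
  rcases ht.eq_or_lt with rfl | ht
  · simp [stableKernel, Real.zero_rpow hα.ne']
  · have hs : Real.sign (t * s) = Real.sign s := by
      rcases lt_trichotomy s 0 with h | rfl | h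
      · rw [Real.sign_of_neg h, Real.sign_of_neg (mul_neg_of_pos_of_neg ht h)]
      · simp
      · rw [Real.sign_of_pos h, Real.sign_of_pos (mul_pos ht h)]
    rw [stableKernel, stableKernel, hs, abs_mul, abs_of_pos ht,
      Real.mul_rpow ht.le (abs_nonneg s)]
    push_cast
    ring

lemma stableKernel_re (α s : ℝ) : (stableKernel α s).re = |s| ^ α := by
  rw [stableKernel, Complex.re_ofReal_mul]
  simp only [← Complex.ofReal_mul, mul_assoc, Complex.sub_re, Complex.one_re, Complex.I_mul_re,
    Complex.ofReal_im, neg_zero, sub_zero, mul_one]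

lemma stableKernel_neg (α s : ℝ) :
    stableKernel α (-s) = (starRingEnd ℂ) (stableKernel α s) := by
  simp only [stableKernel, abs_neg, Real.sign_neg, map_mul, map_sub, map_one, Complex.conj_I,
    Complex.conj_ofReal]
  push_cast
  ring

section StableExponent
variable {d : ℕ} {α : ℝ} {Λ : Measure (Sph d)}

lemma continuous_inner_sphere (z : Ed d) : Continuous fun v : Sph d => ⟪z, (v : Ed d)⟫ := by
  fun_prop

lemma integrable_stableKernel [IsFiniteMeasure Λ] (hα : 0 < α) (z : Ed d) :
    Integrable (fun v : Sph d => stableKernel α ⟪z, (v : Ed d)⟫) Λ :=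
  ((continuous_stableKernel hα).comp (continuous_inner_sphere z)).integrable_of_hasCompactSupport
    (HasCompactSupport.of_compactSpace _)

lemma charExp_smul (hα : 0 < α) {t : ℝ} (ht : 0 ≤ t) (z : Ed d) :
    charExp d α Λ (t • z) = ((t ^ α : ℝ) : ℂ) * charExp d α Λ z := by
  rw [charExp_eq, charExp_eq, ← integral_const_mul]
  refine integral_congr_ae (Eventually.of_forall fun v => ?_)
  simp only [real_inner_smul_left]
  exact stableKernel_mul hα ht _

lemma continuous_charExp [IsFiniteMeasure Λ] (hα : 0 < α) : Continuous (charExp d α Λ) := by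
  have h : Continuous (Function.uncurry fun (z : Ed d) (v : Sph d) =>
      stableKernel α ⟪z, (v : Ed d)⟫) :=
    (continuous_stableKernel hα).comp (by fun_prop)
  have := continuous_parametric_integral_of_continuous (μ := Λ) h (s := Set.univ) isCompact_univ
  simp only [Measure.restrict_univ] at this
  exact this

lemma charExp_re [IsFiniteMeasure Λ] (hα : 0 < α) (z : Ed d) :
    (charExp d α Λ z).re = ∫ v, |⟪z, (v : Ed d)⟫| ^ α ∂Λ := by
  have h := integral_re (integrable_stableKernel (Λ := Λ) hα z)
  simp only [RCLike.re_to_complex, stableKernel_re] at h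
  rw [charExp_eq, h]

lemma charExp_neg (z : Ed d) : charExp d α Λ (-z) = (starRingEnd ℂ) (charExp d α Λ z) := by
  rw [charExp_eq, charExp_eq, ← integral_conj]
  simp only [inner_neg_left, stableKernel_neg]

lemma continuous_Vfun [IsFiniteMeasure Λ] (hα : 0 < α) : Continuous (Vfun d α Λ) :=
  (continuous_charExp hα).comp continuous_subtype_val

lemma charExp_eq_zero_of_re [IsFiniteMeasure Λ] (hα : 0 < α) (z : Ed d)
    (h : (charExp d α Λ z).re = 0) : charExp d α Λ z = 0 := by
  rw [charExp_re hα] at h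
  have hint : Integrable (fun v : Sph d => |⟪z, (v : Ed d)⟫| ^ α) Λ := by
    have := (integrable_stableKernel (Λ := Λ) hα z).re
    simpa only [RCLike.re_to_complex, stableKernel_re] using this
  rw [integral_eq_zero_iff_of_nonneg (fun v => Real.rpow_nonneg (abs_nonneg _) α) hint] at h
  rw [charExp_eq]
  refine integral_eq_zero_of_ae ?_
  filter_upwards [h] with v hv
  simp only [Pi.zero_apply] at hv
  simp [stableKernel, hv]

lemma Vfun_re_pos [IsFiniteMeasure Λ] (hα : 0 < α)
    {μ : Measure (Ed d)} [IsProbabilityMeasure μ] (hμ : IsStableChar d α Λ μ)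
    (hnd : Nondegenerate d μ) (u : Sph d) : 0 < (Vfun d α Λ u).re := by
  have h0 : 0 ≤ (Vfun d α Λ u).re := by
    rw [Vfun, charExp_re hα]
    exact integral_nonneg fun v => Real.rpow_nonneg (abs_nonneg _) α
  refine lt_of_le_of_ne h0 fun h => ?_
  have hz : charExp d α Λ (u : Ed d) = 0 := charExp_eq_zero_of_re hα _ h.symm
  have hline : ∀ t : ℝ, charExp d α Λ (t • (u : Ed d)) = 0 := by
    intro t
    rcases le_total 0 t with ht | ht
    · rw [charExp_smul hα ht, hz, mul_zero]
    · have : t • (u : Ed d) = -((-t) • (u : Ed d)) := by simp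
      rw [this, charExp_neg, charExp_smul hα (by linarith), hz, mul_zero, map_zero]
  have hmeas : Measurable fun x : Ed d => ⟪(u : Ed d), x⟫ := by fun_prop
  have hmap : μ.map (fun x : Ed d => ⟪(u : Ed d), x⟫) = Measure.dirac 0 := by
    have : IsProbabilityMeasure (μ.map (fun x : Ed d => ⟪(u : Ed d), x⟫)) :=
      Measure.isProbabilityMeasure_map hmeas.aemeasurable
    refine Measure.ext_of_charFun ?_
    funext t
    rw [charFun_dirac, charFun_apply_real, integral_map hmeas.aemeasurable (by fun_prop)]
    have h := hμ (t • (u : Ed d))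
    rw [hline, neg_zero, Complex.exp_zero] at h
    simp only [inner_zero_left, Complex.ofReal_zero, zero_mul, Complex.exp_zero]
    rw [← h]
    refine integral_congr_ae (Eventually.of_forall fun x => ?_)
    simp only [real_inner_smul_left]
    push_cast
    ring_nf
  have hmem : μ ((fun x : Ed d => ⟪(u : Ed d), x⟫) ⁻¹' {0}) = 1 := by
    rw [← Measure.map_apply hmeas (measurableSet_singleton 0), hmap]
    simp
  have hu : ⟪(u : Ed d), (u : Ed d)⟫ = 1 := by
    rw [real_inner_self_eq_norm_sq, norm_eq_of_mem_sphere u, one_pow]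
  refine (hnd 0 (LinearMap.ker (innerₛₗ ℝ (u : Ed d))) ?_).ne ?_
  · intro htop
    have : (u : Ed d) ∈ LinearMap.ker (innerₛₗ ℝ (u : Ed d)) := by rw [htop]; trivial
    rw [LinearMap.mem_ker, innerₛₗ_apply_apply, hu] at this
    exact one_ne_zero this
  · rw [← hmem]
    congr 1
    ext x
    simp

lemma exists_le_Vfun_re [IsFiniteMeasure Λ] (hα : 0 < α)
    {μ : Measure (Ed d)} [IsProbabilityMeasure μ] (hμ : IsStableChar d α Λ μ)
    (hnd : Nondegenerate d μ) : ∃ c : ℝ, 0 < c ∧ ∀ u : Sph d, c ≤ (Vfun d α Λ u).re := by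
  rcases isEmpty_or_nonempty (Sph d) with hE | hE
  · exact ⟨1, one_pos, fun u => hE.elim u⟩
  · obtain ⟨u₀, -, hu₀⟩ := isCompact_univ.exists_isMinOn Set.univ_nonempty
      (Complex.continuous_re.comp (continuous_Vfun (Λ := Λ) hα)).continuousOn
    exact ⟨_, Vfun_re_pos hα hμ hnd u₀, fun u => hu₀ (Set.mem_univ u)⟩

lemma charExp_eq_norm (hα : 0 < α) (z : Ed d) (hz : z ≠ 0) :
    charExp d α Λ z = ((‖z‖ ^ α : ℝ) : ℂ) * Vfun d α Λ (unitize z hz) := by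
  rw [Vfun, unitize, ← charExp_smul hα (norm_nonneg z), smul_smul,
    mul_inv_cancel₀ (norm_ne_zero_iff.2 hz), one_smul]

lemma charExp_zero (hα : 0 < α) : charExp d α Λ 0 = 0 := by
  simp [charExp_eq, stableKernel, Real.zero_rpow hα.ne']

lemma le_charExp_re (hα : 0 < α) {c : ℝ} (hc : ∀ u : Sph d, c ≤ (Vfun d α Λ u).re) (z : Ed d) :
    c * ‖z‖ ^ α ≤ (charExp d α Λ z).re := by
  rcases eq_or_ne z 0 with rfl | hz
  · simp [charExp_zero hα, Real.zero_rpow hα.ne']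
  · rw [charExp_eq_norm hα z hz, Complex.re_ofReal_mul, mul_comm]
    exact mul_le_mul_of_nonneg_left (hc _) (by positivity)

end StableExponent

section Polar
variable {d : ℕ}

instance (d : ℕ) : IsFiniteMeasure (ωd d) := by unfold ωd; infer_instance

lemma finrank_Ed (d : ℕ) : Module.finrank ℝ (Ed d) = d := finrank_euclideanSpace_fin

lemma lintegral_polar (hd : 2 ≤ d) {F : Ed d → ℝ≥0∞} (hF : Measurable F) :
    ∫⁻ z, F z = ∫⁻ u, (∫⁻ r in Set.Ioi (0 : ℝ),
      ENNReal.ofReal (r ^ (d - 1)) * F (r • (u : Ed d))) ∂(ωd d) := by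
  have : Nontrivial (Ed d) := Module.nontrivial_of_finrank_pos (R := ℝ) (by rw [finrank_Ed]; omega)
  have hm : Measurable fun p : Sph d × Set.Ioi (0 : ℝ) => F ((p.2 : ℝ) • (p.1 : Ed d)) :=
    hF.comp (by fun_prop)
  calc ∫⁻ z, F z = ∫⁻ x : ({(0)}ᶜ : Set (Ed d)), F x ∂(volume.comap
          (Subtype.val : ({(0 : Ed d)}ᶜ : Set (Ed d)) → Ed d)) := by
        rw [lintegral_subtype_comap (measurableSet_singleton _).compl, restrict_compl_singleton]
    _ = ∫⁻ p, F ((p.2 : ℝ) • (p.1 : Ed d)) ∂((ωd d).prod (.volumeIoiPow (d - 1))) := by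
        have h := (Measure.measurePreserving_homeomorphUnitSphereProd
          (volume : Measure (Ed d))).lintegral_comp_emb
            (Homeomorph.measurableEmbedding _) (fun p => F ((p.2 : ℝ) • (p.1 : Ed d)))
        rw [finrank_Ed] at h
        rw [ωd, ← h]
        refine lintegral_congr fun x => ?_
        congr 1
        simp [smul_smul, mul_inv_cancel₀ (norm_ne_zero_iff.2 x.2)]
    _ = _ := by
        rw [lintegral_prod _ hm.aemeasurable]
        refine lintegral_congr fun u => ?_
        have hu : Measurable fun r : ℝ => F (r • (u : Ed d)) := hF.comp (by fun_prop)
        rw [Measure.volumeIoiPow]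
        refine (lintegral_withDensity_eq_lintegral_mul _ (by fun_prop)
          (hu.comp measurable_subtype_coe)).trans ?_
        rw [← lintegral_subtype_comap measurableSet_Ioi]
        rfl

lemma integral_polar (hd : 2 ≤ d) {F : Ed d → ℂ} (hF : Integrable F) :
    ∫ z, F z = ∫ u, (∫ r in Set.Ioi (0 : ℝ),
      ((r ^ (d - 1) : ℝ) : ℂ) * F (r • (u : Ed d))) ∂(ωd d) := by
  have : Nontrivial (Ed d) := Module.nontrivial_of_finrank_pos (R := ℝ) (by rw [finrank_Ed]; omega)
  have hmp := Measure.measurePreserving_homeomorphUnitSphereProd (volume : Measure (Ed d))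
  rw [finrank_Ed] at hmp
  have hcomp : ((fun p : Sph d × Set.Ioi (0 : ℝ) => F ((p.2 : ℝ) • (p.1 : Ed d))) ∘
      homeomorphUnitSphereProd (Ed d)) = fun x : ({(0)}ᶜ : Set (Ed d)) => F x := by
    funext x
    simp [smul_smul, mul_inv_cancel₀ (norm_ne_zero_iff.2 x.2)]
  have hint : Integrable (fun p : Sph d × Set.Ioi (0 : ℝ) => F ((p.2 : ℝ) • (p.1 : Ed d)))
      ((ωd d).prod (.volumeIoiPow (d - 1))) := by
    rw [ωd, ← hmp.integrable_comp_emb (Homeomorph.measurableEmbedding _), hcomp]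
    have := hF.integrableOn (s := {(0 : Ed d)}ᶜ)
    rwa [integrableOn_iff_comap_subtypeVal (measurableSet_singleton _).compl] at this
  calc ∫ z, F z = ∫ x : ({(0)}ᶜ : Set (Ed d)), F x ∂(volume.comap
          (Subtype.val : ({(0 : Ed d)}ᶜ : Set (Ed d)) → Ed d)) := by
        rw [integral_subtype_comap (measurableSet_singleton _).compl, restrict_compl_singleton]
    _ = ∫ p, F ((p.2 : ℝ) • (p.1 : Ed d)) ∂((ωd d).prod (.volumeIoiPow (d - 1))) := by
        rw [ωd, ← hmp.integral_comp (Homeomorph.measurableEmbedding _), ← hcomp]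
        rfl
    _ = _ := by
        rw [integral_prod _ hint]
        refine integral_congr_ae (Eventually.of_forall fun u => ?_)
        simp only [Measure.volumeIoiPow, ENNReal.ofReal]
        rw [integral_withDensity_eq_integral_smul
            ((measurable_subtype_coe.pow_const _).real_toNNReal),
          integral_subtype_comap measurableSet_Ioi
            fun r : ℝ => Real.toNNReal (r ^ (d - 1)) • F (r • (u : Ed d))]
        refine setIntegral_congr_fun measurableSet_Ioi fun r hr => ?_
        simp only [NNReal.smul_def]
        rw [Real.coe_toNNReal _ (pow_nonneg (Set.mem_Ioi.1 hr).le _), Complex.real_smul]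

end Polar

section Gamma
variable {α : ℝ}

lemma integral_pow_mul_exp_neg_mul_rpow (hα : 0 < α) {c : ℝ} (hc : 0 < c) (k : ℕ) :
    ∫ r in Set.Ioi (0 : ℝ), r ^ k * Real.exp (-c * r ^ α) =
      c ^ (-((k : ℝ) + 1) / α) * (1 / α) * Real.Gamma (((k : ℝ) + 1) / α) := by
  rw [← integral_rpow_mul_exp_neg_mul_rpow hα
    (by have : (0 : ℝ) ≤ k := by positivity
        linarith : (-1 : ℝ) < k) hc]
  simp only [Real.rpow_natCast]

lemma integrableOn_pow_mul_exp_neg_mul_rpow (hα : 0 < α) {c : ℝ} (hc : 0 < c) (k : ℕ) :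
    IntegrableOn (fun r : ℝ => r ^ k * Real.exp (-c * r ^ α)) (Set.Ioi 0) := by
  have := integrableOn_rpow_mul_exp_neg_mul_rpow (s := (k : ℝ)) (p := α) (b := c)
    (by have : (0 : ℝ) ≤ k := by positivity
        linarith) hα hc
  simpa only [Real.rpow_natCast] using this

lemma integral_cpow_mul_cexp_neg_mul {a : ℝ} (ha : 0 < a) {V : ℂ} (hV : 0 < V.re) :
    ∫ t in Set.Ioi (0 : ℝ), (t : ℂ) ^ ((a : ℂ) - 1) * Complex.exp (-(V * t)) =
      (1 / V) ^ (a : ℂ) * Complex.Gamma a := by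
  have hmeas : ∀ z : ℂ, AEStronglyMeasurable
      (fun t : ℝ => (t : ℂ) ^ ((a : ℂ) - 1) * Complex.exp (-(z * t)))
      (volume.restrict (Set.Ioi 0)) := fun z => by
    refine ContinuousOn.aestronglyMeasurable (fun t ht => ?_) measurableSet_Ioi
    have : (t : ℂ) ∈ Complex.slitPlane := Complex.ofReal_mem_slitPlane.2 ht
    exact ((Complex.continuous_ofReal.continuousAt.cpow continuousAt_const this).mul
      (by fun_prop)).continuousWithinAt
  have hnorm : ∀ (z : ℂ) (t : ℝ), 0 < t →
      ‖(t : ℂ) ^ ((a : ℂ) - 1) * Complex.exp (-(z * t))‖ =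
        t ^ (a - 1) * Real.exp (-z.re * t) := fun z t ht => by
    rw [norm_mul, Complex.norm_cpow_eq_rpow_re_of_pos ht, Complex.norm_exp]
    simp
  have hbound : ∀ s : ℝ, -1 < s → ∀ c : ℝ, 0 < c → IntegrableOn
      (fun t : ℝ => t ^ s * Real.exp (-c * t)) (Set.Ioi 0) := fun s hs c hc => by
    simpa using integrableOn_rpow_mul_exp_neg_mul_rpow hs one_pos hc
  have hdiff : DifferentiableOn ℂ (fun z : ℂ => ∫ t in Set.Ioi (0 : ℝ),
      (t : ℂ) ^ ((a : ℂ) - 1) * Complex.exp (-(z * t))) {z | 0 < z.re} := by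
    intro z hz
    have hz : 0 < z.re := hz
    refine (hasDerivAt_integral_of_dominated_loc_of_deriv_le
      (F' := fun z (t : ℝ) => -(t : ℂ) * ((t : ℂ) ^ ((a : ℂ) - 1) * Complex.exp (-(z * t))))
      (s := {w | z.re / 2 < w.re}) (bound := fun t => t ^ a * Real.exp (-(z.re / 2) * t))
      ((isOpen_lt continuous_const Complex.continuous_re).mem_nhds (by
        change z.re / 2 < z.re; linarith))
      (Eventually.of_forall hmeas) ?_ ?_ ?_ (hbound a (by linarith) _ (by linarith))
      ?_).2.differentiableAt.differentiableWithinAt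
    · refine (integrable_norm_iff (hmeas z)).1 ((hbound (a - 1) (by linarith) _ hz).congr ?_)
      exact (ae_restrict_mem measurableSet_Ioi).mono fun t ht => (hnorm z t ht).symm
    · exact (Complex.measurable_ofReal.neg.aestronglyMeasurable).mul (hmeas z)
    · refine (ae_restrict_mem measurableSet_Ioi).mono fun t ht w hw => ?_
      have ht : 0 < t := ht
      have hw : z.re / 2 < w.re := hw
      rw [norm_mul, hnorm w t ht, norm_neg, Complex.norm_real, Real.norm_of_nonneg ht.le,
        ← mul_assoc, ← Real.rpow_one_add' ht.le (by linarith), add_sub_cancel]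
      gcongr
    · refine Eventually.of_forall fun t w _ => ?_
      have h1 : HasDerivAt (fun w : ℂ => -(w * t)) (-(t : ℂ)) w := by
        exact ((hasDerivAt_id w).mul_const (t : ℂ)).neg.congr_deriv (by simp)
      exact (h1.cexp.const_mul ((t : ℂ) ^ ((a : ℂ) - 1))).congr_deriv (by ring)
  have hdiff' : DifferentiableOn ℂ (fun z : ℂ => (1 / z) ^ (a : ℂ) * Complex.Gamma a)
      {z | 0 < z.re} := by
    intro z hz
    have hz : 0 < z.re := hz
    have hz0 : z ≠ 0 := fun h => by simp [h] at hz
    refine DifferentiableAt.differentiableWithinAt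
      (DifferentiableAt.mul_const (DifferentiableAt.cpow_const ?_ ?_) _)
    · exact (differentiableAt_const _).div differentiableAt_id hz0
    · left
      simp only [one_div, Complex.inv_re]
      exact div_pos hz (Complex.normSq_pos.2 hz0)
  have hopen : IsOpen {z : ℂ | 0 < z.re} := isOpen_lt continuous_const Complex.continuous_re
  refine (hdiff.analyticOnNhd hopen).eqOn_of_preconnected_of_frequently_eq
    (hdiff'.analyticOnNhd hopen) (convex_halfSpace_re_gt 0).isPreconnected
    (z₀ := 1) (by simp) ?_ hV
  have hlim : Tendsto (fun n : ℕ => ((1 + 1 / ((n : ℝ) + 1) : ℝ) : ℂ)) atTop (𝓝[≠] 1) := by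
    refine tendsto_nhdsWithin_iff.2 ⟨?_, Eventually.of_forall fun n => ?_⟩
    · have h1 : Tendsto (fun n : ℕ => 1 + 1 / ((n : ℝ) + 1)) atTop (𝓝 (1 + 0)) :=
        tendsto_one_div_add_atTop_nhds_zero_nat.const_add 1
      simpa [Function.comp_def] using (Complex.continuous_ofReal.tendsto _).comp h1
    · have : (0 : ℝ) < 1 / ((n : ℝ) + 1) := by positivity
      simp only [Set.mem_compl_iff, Set.mem_singleton_iff]
      intro h
      have h := Complex.ofReal_injective (h.trans Complex.ofReal_one.symm)
      linarith
  refine hlim.frequently (Eventually.frequently (Eventually.of_forall fun n => ?_))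
  exact Complex.integral_cpow_mul_exp_neg_mul_Ioi (by simpa) (by positivity)

lemma integral_pow_mul_cexp_neg_rpow_mul (hα : 0 < α) {V : ℂ} (hV : 0 < V.re) (k : ℕ) :
    ∫ r in Set.Ioi (0 : ℝ), ((r ^ k : ℝ) : ℂ) * Complex.exp (-(((r ^ α : ℝ) : ℂ) * V)) =
      ((Real.Gamma (((k : ℝ) + 1) / α) / α : ℝ) : ℂ) * V ^ ((-(((k : ℝ) + 1) / α) : ℝ) : ℂ) := by
  set a : ℝ := ((k : ℝ) + 1) / α with ha
  have ha0 : 0 < a := by positivity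
  have h1 := integral_cpow_mul_cexp_neg_mul ha0 hV
  have h2 := integral_comp_rpow_Ioi
    (fun t : ℝ => (t : ℂ) ^ ((a : ℂ) - 1) * Complex.exp (-(V * t))) hα.ne'
  rw [h1] at h2
  have h3 : ∫ r in Set.Ioi (0 : ℝ), (|α| * r ^ (α - 1)) •
      (((r ^ α : ℝ) : ℂ) ^ ((a : ℂ) - 1) * Complex.exp (-(V * ((r ^ α : ℝ) : ℂ)))) =
      (α : ℂ) * ∫ r in Set.Ioi (0 : ℝ),
        ((r ^ k : ℝ) : ℂ) * Complex.exp (-(((r ^ α : ℝ) : ℂ) * V)) := by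
    rw [← integral_const_mul]
    refine setIntegral_congr_fun measurableSet_Ioi fun r hr => ?_
    have hr : 0 < r := hr
    have e1 : ((r ^ α : ℝ) : ℂ) ^ ((a : ℂ) - 1) = (((r ^ α) ^ (a - 1) : ℝ) : ℂ) := by
      rw [Complex.ofReal_cpow (x := r ^ α) (by positivity), Complex.ofReal_sub, Complex.ofReal_one]
    have e2 : r ^ (α - 1) * (r ^ α) ^ (a - 1) = r ^ k := by
      rw [← Real.rpow_mul hr.le, ← Real.rpow_add hr, ← Real.rpow_natCast]
      congr 1
      rw [ha]
      field_simp
      ring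
    simp only [abs_of_pos hα, e1, Complex.real_smul]
    rw [← e2]
    push_cast
    ring_nf
  rw [h3] at h2
  have hα' : (α : ℂ) ≠ 0 := by exact_mod_cast hα.ne'
  rw [← mul_right_inj' hα', h2, Complex.ofReal_neg, Complex.cpow_neg, one_div,
    Complex.inv_cpow _ _ (by
      rw [Ne, Complex.arg_eq_pi_iff]
      exact fun h => absurd h.1 (not_lt.2 hV.le)), Complex.Gamma_ofReal]
  push_cast
  field_simp

lemma exists_mul_sub_rpow_le (hα : 1 < α) {K : ℝ} (hK : 0 < K) :
    ∃ C : ℝ, ∀ r : ℝ, 0 < r → K * r - r ^ α ≤ C - (1 / 2) * r ^ α := by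
  refine ⟨K * (2 * K) ^ (1 / (α - 1)), fun r hr => ?_⟩
  have hsplit : r ^ α = r * r ^ (α - 1) := by
    rw [← Real.rpow_one_add' hr.le (by linarith)]
    congr 1
    ring
  have hα' : 0 < α - 1 := by linarith
  rcases le_total (2 * K) (r ^ (α - 1)) with h | h
  · have : 0 ≤ K * (2 * K) ^ (1 / (α - 1)) := by positivity
    rw [hsplit]
    nlinarith
  · have h2 : r ≤ (2 * K) ^ (1 / (α - 1)) := by
      have := Real.rpow_le_rpow (by positivity) h (by positivity : 0 ≤ 1 / (α - 1))
      rwa [← Real.rpow_mul hr.le, mul_one_div_cancel hα'.ne', Real.rpow_one] at this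
    have h3 : 0 ≤ r ^ α := by positivity
    nlinarith

lemma summable_Gamma_mul_pow_div_factorial (hα : 1 < α) (d : ℕ) (hd : 1 ≤ d) {K : ℝ}
    (hK : 0 < K) :
    Summable fun n : ℕ => Real.Gamma (((n : ℝ) + d) / α) * K ^ n / (Nat.factorial n : ℝ) := by
  obtain ⟨C, hC⟩ := exists_mul_sub_rpow_le hα hK
  have hα0 : 0 < α := by linarith
  have hcast : ((d - 1 : ℕ) : ℝ) = d - 1 := by rw [Nat.cast_sub hd]; simp
  have hval : ∀ n : ℕ, Real.Gamma (((n : ℝ) + d) / α) * K ^ n / (Nat.factorial n : ℝ) =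
      α * ∫ r in Set.Ioi (0 : ℝ),
        K ^ n / Nat.factorial n * (r ^ (n + (d - 1)) * Real.exp (-1 * r ^ α)) := by
    intro n
    rw [integral_const_mul, integral_pow_mul_exp_neg_mul_rpow hα0 one_pos]
    have : ((n + (d - 1) : ℕ) : ℝ) + 1 = n + d := by push_cast; rw [hcast]; ring
    rw [this, Real.one_rpow]
    field_simp
  have hint : ∀ n : ℕ, IntegrableOn (fun r : ℝ =>
      K ^ n / Nat.factorial n * (r ^ (n + (d - 1)) * Real.exp (-1 * r ^ α))) (Set.Ioi 0) :=
    fun n => (integrableOn_pow_mul_exp_neg_mul_rpow hα0 one_pos _).const_mul _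
  refine summable_of_sum_range_le (c := α * ∫ r in Set.Ioi (0 : ℝ),
    Real.exp C * (r ^ (d - 1) * Real.exp (-(1 / 2) * r ^ α))) (fun n => ?_) (fun N => ?_)
  · have := Real.Gamma_nonneg_of_nonneg (show 0 ≤ ((n : ℝ) + d) / α by positivity)
    positivity
  · rw [Finset.sum_congr rfl fun n _ => hval n, ← Finset.mul_sum,
      ← integral_finsetSum _ fun n _ => hint n]
    refine mul_le_mul_of_nonneg_left ?_ hα0.le
    refine setIntegral_mono_on (integrable_finsetSum _ fun n _ => hint n)
      ((integrableOn_pow_mul_exp_neg_mul_rpow hα0 (by norm_num) _).const_mul _)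
      measurableSet_Ioi fun r hr => ?_
    have hr : 0 < r := hr
    calc ∑ n ∈ Finset.range N,
          K ^ n / Nat.factorial n * (r ^ (n + (d - 1)) * Real.exp (-1 * r ^ α))
        = (∑ n ∈ Finset.range N, (K * r) ^ n / Nat.factorial n) *
          (r ^ (d - 1) * Real.exp (-1 * r ^ α)) := by
          rw [Finset.sum_mul]
          refine Finset.sum_congr rfl fun n _ => ?_
          rw [mul_pow, pow_add]
          ring
      _ ≤ Real.exp (K * r) * (r ^ (d - 1) * Real.exp (-1 * r ^ α)) := by
          gcongr
          exact Real.sum_le_exp_of_nonneg (by positivity) N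
      _ = r ^ (d - 1) * Real.exp (K * r - r ^ α) := by
          rw [sub_eq_add_neg, Real.exp_add]
          ring_nf
      _ ≤ r ^ (d - 1) * Real.exp (C - (1 / 2) * r ^ α) := by
          exact mul_le_mul_of_nonneg_left (Real.exp_le_exp.2 (hC r hr)) (by positivity)
      _ = Real.exp C * (r ^ (d - 1) * Real.exp (-(1 / 2) * r ^ α)) := by
          rw [sub_eq_add_neg, Real.exp_add]
          ring_nf

end Gamma

section Expansion
variable {d : ℕ} {α : ℝ} {Λ : Measure (Sph d)}

lemma norm_sphere (u : Sph d) : ‖(u : Ed d)‖ = 1 := by simp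

lemma charExp_eq_Vfun_of_smul (hα : 0 < α) {r : ℝ} (hr : 0 < r) (u : Sph d) :
    charExp d α Λ (r • (u : Ed d)) = ((r ^ α : ℝ) : ℂ) * Vfun d α Λ u :=
  charExp_smul hα hr.le _

lemma norm_cexp_neg_charExp_le (hα : 0 < α) {c : ℝ}
    (hc : ∀ u : Sph d, c ≤ (Vfun d α Λ u).re) (z : Ed d) :
    ‖Complex.exp (-charExp d α Λ z)‖ ≤ Real.exp (-c * ‖z‖ ^ α) := by
  rw [Complex.norm_exp, Complex.neg_re, neg_mul]
  exact Real.exp_le_exp.2 (neg_le_neg (le_charExp_re hα hc z))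

lemma integrable_norm_pow_mul_exp (hd : 2 ≤ d) (hα : 0 < α) {c : ℝ} (hc : 0 < c) (n : ℕ) :
    Integrable fun z : Ed d => ‖z‖ ^ n * Real.exp (-c * ‖z‖ ^ α) := by
  have : Nontrivial (Ed d) := Module.nontrivial_of_finrank_pos (R := ℝ) (by rw [finrank_Ed]; omega)
  rw [integrable_fun_norm_addHaar volume (f := fun r : ℝ => r ^ n * Real.exp (-c * r ^ α)),
    finrank_Ed]
  simpa only [smul_eq_mul, ← mul_assoc, ← pow_add] using
    integrableOn_pow_mul_exp_neg_mul_rpow hα hc (d - 1 + n)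

lemma integral_norm_pow_mul_exp (hd : 2 ≤ d) (hα : 0 < α) {c : ℝ} (hc : 0 < c) (n : ℕ) :
    ∫ z : Ed d, ‖z‖ ^ n * Real.exp (-c * ‖z‖ ^ α) =
      (ωd d).real Set.univ * (c ^ (-((n : ℝ) + d) / α) * (1 / α) *
        Real.Gamma (((n : ℝ) + d) / α)) := by
  have : Nontrivial (Ed d) := Module.nontrivial_of_finrank_pos (R := ℝ) (by rw [finrank_Ed]; omega)
  rw [integral_fun_norm_addHaar volume (fun r : ℝ => r ^ n * Real.exp (-c * r ^ α)), finrank_Ed,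
    ωd, Measure.toSphere_real_apply_univ, finrank_Ed]
  simp only [smul_eq_mul, ← mul_assoc, ← pow_add, nsmul_eq_mul]
  rw [integral_pow_mul_exp_neg_mul_rpow hα hc]
  have : ((d - 1 + n : ℕ) : ℝ) + 1 = n + d := by
    push_cast [Nat.cast_sub (show 1 ≤ d by omega)]
    ring
  rw [this]
  ring

lemma rpow_neg_add_div {c : ℝ} (hc : 0 < c) (α : ℝ) (n d : ℕ) :
    c ^ (-((n : ℝ) + d) / α) = c ^ (-(d : ℝ) / α) * (c ^ (-1 / α)) ^ n := by
  rw [← Real.rpow_natCast, ← Real.rpow_mul hc.le, ← Real.rpow_add hc]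
  ring_nf

lemma summable_integral_norm_pow_mul_exp (hd : 2 ≤ d) (hα : 1 < α) {c : ℝ} (hc : 0 < c)
    {M : ℝ} (hM : 0 < M) :
    Summable fun n : ℕ => M ^ n / (Nat.factorial n : ℝ) *
      ∫ z : Ed d, ‖z‖ ^ n * Real.exp (-c * ‖z‖ ^ α) := by
  have hα0 : 0 < α := by linarith
  refine ((summable_Gamma_mul_pow_div_factorial hα d (by omega)
    (K := M * c ^ (-1 / α)) (by positivity)).mul_left
      ((ωd d).real Set.univ * c ^ (-(d : ℝ) / α) * (1 / α))).congr fun n => ?_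
  rw [integral_norm_pow_mul_exp hd hα0 hc, rpow_neg_add_div hc, mul_pow]
  ring

lemma integrable_inner_pow_mul_cexp_neg_charExp [IsFiniteMeasure Λ] (hd : 2 ≤ d) (hα : 0 < α)
    {c : ℝ} (hc0 : 0 < c) (hc : ∀ u : Sph d, c ≤ (Vfun d α Λ u).re) (x : Ed d) (n : ℕ) :
    Integrable fun z : Ed d => (⟪x, z⟫ : ℂ) ^ n * Complex.exp (-charExp d α Λ z) := by
  refine ((integrable_norm_pow_mul_exp hd hα hc0 n).const_mul (‖x‖ ^ n)).mono'
    (Continuous.aestronglyMeasurable ?_) (Eventually.of_forall fun z => ?_)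
  · have := continuous_charExp (d := d) (Λ := Λ) hα
    fun_prop
  · rw [norm_mul, norm_pow, Complex.norm_real, ← mul_assoc, ← mul_pow]
    gcongr
    · exact norm_inner_le_norm x z
    · exact norm_cexp_neg_charExp_le hα hc z

lemma integrable_cexp_neg_charExp [IsFiniteMeasure Λ] (hd : 2 ≤ d) (hα : 0 < α)
    {c : ℝ} (hc0 : 0 < c) (hc : ∀ u : Sph d, c ≤ (Vfun d α Λ u).re) :
    Integrable fun z : Ed d => Complex.exp (-charExp d α Λ z) := by
  simpa using integrable_inner_pow_mul_cexp_neg_charExp hd hα hc0 hc 0 0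

lemma integral_inner_pow_mul_cexp_neg_charExp [IsFiniteMeasure Λ] (hd : 2 ≤ d) (hα : 0 < α)
    {c : ℝ} (hc0 : 0 < c) (hc : ∀ u : Sph d, c ≤ (Vfun d α Λ u).re) (x : Ed d) (n : ℕ) :
    ∫ z : Ed d, (⟪x, z⟫ : ℂ) ^ n * Complex.exp (-charExp d α Λ z) =
      ((Real.Gamma (((n : ℝ) + d) / α) / α : ℝ) : ℂ) *
        ∫ v : Sph d, (⟪x, (v : Ed d)⟫ : ℂ) ^ n *
          Vfun d α Λ v ^ ((-(((n : ℝ) + d) / α) : ℝ) : ℂ) ∂(ωd d) := by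
  rw [integral_polar hd (integrable_inner_pow_mul_cexp_neg_charExp hd hα hc0 hc x n),
    ← integral_const_mul]
  refine integral_congr_ae (Eventually.of_forall fun v => ?_)
  have hcast : ((d - 1 + n : ℕ) : ℝ) + 1 = n + d := by
    push_cast [Nat.cast_sub (show 1 ≤ d by omega)]
    ring
  have h := integral_pow_mul_cexp_neg_rpow_mul hα (hc0.trans_le (hc v)) (d - 1 + n)
  rw [hcast] at h
  calc _ = ∫ r in Set.Ioi (0 : ℝ), (⟪x, (v : Ed d)⟫ : ℂ) ^ n * (((r ^ (d - 1 + n) : ℝ) : ℂ) *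
        Complex.exp (-(((r ^ α : ℝ) : ℂ) * Vfun d α Λ v))) := by
        refine setIntegral_congr_fun measurableSet_Ioi fun r hr => ?_
        simp only [charExp_eq_Vfun_of_smul hα hr, real_inner_smul_right, pow_add]
        push_cast
        ring
    _ = _ := by
        rw [integral_const_mul, h]
        ring

lemma hasSum_integral_cexp_inner [IsFiniteMeasure Λ] (hd : 2 ≤ d) (hα : 1 < α)
    {c : ℝ} (hc0 : 0 < c) (hc : ∀ u : Sph d, c ≤ (Vfun d α Λ u).re) (x : Ed d) :
    HasSum (fun n : ℕ => (-Complex.I) ^ n / (Nat.factorial n : ℂ) *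
        (((Real.Gamma (((n : ℝ) + d) / α) / α : ℝ) : ℂ) *
        ∫ v : Sph d, (⟪x, (v : Ed d)⟫ : ℂ) ^ n *
          Vfun d α Λ v ^ ((-(((n : ℝ) + d) / α) : ℝ) : ℂ) ∂(ωd d)))
      (∫ z : Ed d, Complex.exp (-(Complex.I * (⟪x, z⟫ : ℂ))) *
        Complex.exp (-charExp d α Λ z)) := by
  have hα0 : 0 < α := by linarith
  have hint := integrable_inner_pow_mul_cexp_neg_charExp hd hα0 hc0 hc x
  have h := hasSum_integral_of_summable_integral_norm (μ := (volume : Measure (Ed d)))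
    (F := fun (n : ℕ) z => (-Complex.I) ^ n / (Nat.factorial n : ℂ) *
      ((⟪x, z⟫ : ℂ) ^ n * Complex.exp (-charExp d α Λ z)))
    (fun n => (hint n).const_mul _) (by
      refine (summable_integral_norm_pow_mul_exp hd hα hc0 (M := ‖x‖ + 1)
        (by positivity)).of_nonneg_of_le (fun n => integral_nonneg fun z => norm_nonneg _)
        fun n => ?_
      rw [← integral_const_mul]
      refine integral_mono ((hint n).const_mul _).norm
        ((integrable_norm_pow_mul_exp hd hα0 hc0 n).const_mul _) fun z => ?_
      have h1 : ‖(-Complex.I) ^ n / (Nat.factorial n : ℂ)‖ = 1 / (Nat.factorial n : ℝ) := by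
        simp
      have h2 : |⟪x, z⟫| ≤ (‖x‖ + 1) * ‖z‖ :=
        (abs_real_inner_le_norm x z).trans (by gcongr; linarith)
      simp only [norm_mul, h1, norm_pow, Complex.norm_real, Real.norm_eq_abs]
      calc 1 / (Nat.factorial n : ℝ) * (|⟪x, z⟫| ^ n * ‖Complex.exp (-charExp d α Λ z)‖)
          ≤ 1 / (Nat.factorial n : ℝ) * (((‖x‖ + 1) * ‖z‖) ^ n * Real.exp (-c * ‖z‖ ^ α)) := by
            gcongr
            exact norm_cexp_neg_charExp_le hα0 hc z
        _ = _ := by rw [mul_pow]; ring)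
  simp only [integral_const_mul, integral_inner_pow_mul_cexp_neg_charExp hd hα0 hc0 hc] at h
  suffices hs : ∀ z : Ed d, ∑' n : ℕ, (-Complex.I) ^ n / (Nat.factorial n : ℂ) *
      ((⟪x, z⟫ : ℂ) ^ n * Complex.exp (-charExp d α Λ z)) =
      Complex.exp (-(Complex.I * (⟪x, z⟫ : ℂ))) * Complex.exp (-charExp d α Λ z) by
    simpa only [hs] using h
  intro z
  simp only [← mul_assoc]
  rw [tsum_mul_right, Complex.exp_eq_exp_ℂ, NormedSpace.exp_eq_tsum_div]
  congr 1
  refine tsum_congr fun n => ?_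
  rw [← neg_mul, mul_pow]
  ring

lemma hasSum_density [IsFiniteMeasure Λ] (hd : 2 ≤ d) (hα : 1 < α)
    {c : ℝ} (hc0 : 0 < c) (hc : ∀ u : Sph d, c ≤ (Vfun d α Λ u).re)
    {g : Ed d → ℝ} (hg : IsDensityOf d α Λ g) (x : Ed d) :
    HasSum (fun n : ℕ => ((((2 * π) ^ d)⁻¹ : ℝ) : ℂ) *
      ((-Complex.I) ^ n / (Nat.factorial n : ℂ) *
        (((Real.Gamma (((n : ℝ) + d) / α) / α : ℝ) : ℂ) *
        ∫ v : Sph d, (⟪x, (v : Ed d)⟫ : ℂ) ^ n *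
          Vfun d α Λ v ^ ((-(((n : ℝ) + d) / α) : ℝ) : ℂ) ∂(ωd d)))) (g x : ℂ) := by
  rw [hg x]
  exact (hasSum_integral_cexp_inner hd hα hc0 hc x).mul_left _

end Expansion

section Zonal
variable {d : ℕ} {α : ℝ} {Λ : Measure (Sph d)}

lemma abs_inner_sphere_le (u v : Sph d) : |⟪(u : Ed d), (v : Ed d)⟫| ≤ 1 := by
  simpa [norm_sphere] using abs_real_inner_le_norm (u : Ed d) (v : Ed d)

lemma continuous_zonal (d j : ℕ) : Continuous (zonal d j) := by
  unfold zonal gegenbauerN gegenbauer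
  split_ifs
  · fun_prop
  · fun_prop

lemma sphereArea_pos (hd : 2 ≤ d) : 0 < sphereArea d := by
  have : (2 : ℝ) ≤ d := by exact_mod_cast hd
  have := Real.Gamma_pos_of_pos (show (0 : ℝ) < d / 2 by linarith)
  unfold sphereArea
  positivity

lemma integrable_of_continuous_sphere {f : Sph d → ℂ} (hf : Continuous f) :
    Integrable f (ωd d) :=
  hf.integrable_of_hasCompactSupport (HasCompactSupport.of_compactSpace f)

lemma continuous_Vfun_cpow [IsFiniteMeasure Λ] (hα : 0 < α)
    {c : ℝ} (hc0 : 0 < c) (hc : ∀ u : Sph d, c ≤ (Vfun d α Λ u).re) (p : ℂ) :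
    Continuous fun u : Sph d => Vfun d α Λ u ^ p :=
  (continuous_Vfun hα).cpow continuous_const fun u => Or.inl (hc0.trans_le (hc u))

lemma projC_eq_integral_zonal (j : ℕ) (f : Sph d → ℂ) (u : Sph d) :
    projC d j f u = (sphereArea d : ℂ)⁻¹ *
      ∫ v, (zonal d j ⟪(u : Ed d), (v : Ed d)⟫ : ℂ) * f v ∂(ωd d) := by
  have h : ∀ v : Sph d, (zonal d j ⟪(u : Ed d), (v : Ed d)⟫ : ℂ) * f v =
      (cdim d j : ℂ) *
        ((gegenbauerN (((d : ℝ) - 2) / 2) j ⟪(u : Ed d), (v : Ed d)⟫ : ℂ) * f v) := fun v => by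
    rw [zonal]
    push_cast
    ring
  simp only [projC, h, integral_const_mul]
  ring

lemma integral_inner_pow_mul_eq_sum_projC (hd : 2 ≤ d) {f : Sph d → ℂ} (hf : Continuous f)
    (u : Sph d) (n : ℕ) :
    ∫ v : Sph d, (⟪(u : Ed d), (v : Ed d)⟫ : ℂ) ^ n * f v ∂(ωd d) =
      ∑ m ∈ Finset.range (n / 2 + 1),
        (((Nat.factorial n : ℝ) / 2 ^ n * (Real.Gamma ((d : ℝ) / 2) /
          ((Nat.factorial m : ℝ) * Real.Gamma ((n : ℝ) - m + (d : ℝ) / 2))) *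
            sphereArea d : ℝ) : ℂ) * projC d (n - 2 * m) f u := by
  have hA : (sphereArea d : ℂ) ≠ 0 := by exact_mod_cast (sphereArea_pos hd).ne'
  have h : ∀ v : Sph d, (⟪(u : Ed d), (v : Ed d)⟫ : ℂ) ^ n * f v =
      ∑ m ∈ Finset.range (n / 2 + 1),
        (((Nat.factorial n : ℝ) / 2 ^ n * (Real.Gamma ((d : ℝ) / 2) /
          ((Nat.factorial m : ℝ) * Real.Gamma ((n : ℝ) - m + (d : ℝ) / 2))) : ℝ) : ℂ) *
          ((zonal d (n - 2 * m) ⟪(u : Ed d), (v : Ed d)⟫ : ℂ) * f v) := fun v => by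
    rw [← Complex.ofReal_pow, pow_eq_sum_zonal d hd, Finset.mul_sum, Complex.ofReal_sum,
      Finset.sum_mul]
    refine Finset.sum_congr rfl fun m _ => ?_
    push_cast
    ring
  simp only [h]
  rw [integral_finsetSum]
  · refine Finset.sum_congr rfl fun m _ => ?_
    rw [integral_const_mul, projC_eq_integral_zonal]
    push_cast
    field_simp
  · intro m _
    refine (integrable_of_continuous_sphere ?_).const_mul _
    have := (continuous_zonal d (n - 2 * m)).comp (continuous_inner_sphere (u : Ed d))
    exact (Complex.continuous_ofReal.comp this).mul hf

lemma neg_I_pow_eq {n m : ℕ} (h : 2 * m ≤ n) :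
    (-Complex.I) ^ n = (-1) ^ m * (-Complex.I) ^ (n - 2 * m) := by
  conv_lhs => rw [← Nat.add_sub_cancel' h, pow_add, pow_mul]
  simp

lemma density_const_eq (hd : 2 ≤ d) :
    ((2 * π) ^ d)⁻¹ * Real.Gamma ((d : ℝ) / 2) * sphereArea d =
      (2 : ℝ) ^ (1 - (d : ℝ)) / π ^ ((d : ℝ) / 2) := by
  have : (2 : ℝ) ≤ d := by exact_mod_cast hd
  have hG := (Real.Gamma_pos_of_pos (show (0 : ℝ) < d / 2 by linarith)).ne'
  have hπ : π ^ d = π ^ ((d : ℝ) / 2) * π ^ ((d : ℝ) / 2) := by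
    rw [← Real.rpow_add Real.pi_pos, add_halves, Real.rpow_natCast]
  have hπ0 : π ^ ((d : ℝ) / 2) ≠ 0 := (by positivity : 0 < π ^ ((d : ℝ) / 2)).ne'
  rw [sphereArea, mul_pow, hπ, Real.rpow_sub two_pos, Real.rpow_one, Real.rpow_natCast]
  field_simp

lemma density_term_eq (hd : 2 ≤ d) [IsFiniteMeasure Λ] (hα : 0 < α)
    {c : ℝ} (hc0 : 0 < c) (hc : ∀ u : Sph d, c ≤ (Vfun d α Λ u).re)
    (r : ℝ) (u : Sph d) (n : ℕ) :
    ((((2 * π) ^ d)⁻¹ : ℝ) : ℂ) *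
      ((-Complex.I) ^ n / (Nat.factorial n : ℂ) *
        (((Real.Gamma (((n : ℝ) + d) / α) / α : ℝ) : ℂ) *
        ∫ v : Sph d, (⟪r • (u : Ed d), (v : Ed d)⟫ : ℂ) ^ n *
          Vfun d α Λ v ^ ((-(((n : ℝ) + d) / α) : ℝ) : ℂ) ∂(ωd d))) =
      (((2 : ℝ) ^ (1 - (d : ℝ)) / (π ^ ((d : ℝ) / 2) * α) : ℝ) : ℂ) *
        (((Real.Gamma (((n : ℝ) + d) / α) * (r / 2) ^ n : ℝ) : ℂ) *
            ∑ m ∈ Finset.range (n / 2 + 1),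
              (((-1 : ℝ) ^ m / ((Nat.factorial m : ℝ) *
                  Real.Gamma ((n : ℝ) - m + (d : ℝ) / 2)) : ℝ) : ℂ) *
                SHp d α Λ (n - 2 * m) (-(((n : ℝ) + d) / α)) u) := by
  have h : ∀ v : Sph d, (⟪r • (u : Ed d), (v : Ed d)⟫ : ℂ) ^ n *
      Vfun d α Λ v ^ ((-(((n : ℝ) + d) / α) : ℝ) : ℂ) = (r : ℂ) ^ n *
      ((⟪(u : Ed d), (v : Ed d)⟫ : ℂ) ^ n *
        Vfun d α Λ v ^ ((-(((n : ℝ) + d) / α) : ℝ) : ℂ)) := fun v => by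
    rw [real_inner_smul_left, Complex.ofReal_mul, mul_pow, mul_assoc]
  simp only [h]
  rw [integral_const_mul,
    integral_inner_pow_mul_eq_sum_projC hd (continuous_Vfun_cpow hα hc0 hc _)]
  simp only [Finset.mul_sum]
  refine Finset.sum_congr rfl fun m hm => ?_
  have hm : 2 * m ≤ n := by have := Finset.mem_range.1 hm; omega
  have hn : (Nat.factorial n : ℂ) ≠ 0 := by exact_mod_cast Nat.factorial_ne_zero n
  have hα' : (α : ℂ) ≠ 0 := by exact_mod_cast hα.ne'
  rw [SHp, neg_I_pow_eq hm, ← div_div (2 ^ (1 - (d : ℝ))), ← density_const_eq hd, div_pow]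
  push_cast
  field_simp

lemma hasSum_density_zonal (hd : 2 ≤ d) [IsFiniteMeasure Λ] (hα : 1 < α)
    {c : ℝ} (hc0 : 0 < c) (hc : ∀ u : Sph d, c ≤ (Vfun d α Λ u).re)
    {g : Ed d → ℝ} (hg : IsDensityOf d α Λ g) (x : Ed d) (u : Sph d)
    (hx : x = ‖x‖ • (u : Ed d)) :
    HasSum (fun n : ℕ => (((2 : ℝ) ^ (1 - (d : ℝ)) / (π ^ ((d : ℝ) / 2) * α) : ℝ) : ℂ) *
        (((Real.Gamma (((n : ℝ) + d) / α) * (‖x‖ / 2) ^ n : ℝ) : ℂ) *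
            ∑ m ∈ Finset.range (n / 2 + 1),
              (((-1 : ℝ) ^ m / ((Nat.factorial m : ℝ) *
                  Real.Gamma ((n : ℝ) - m + (d : ℝ) / 2)) : ℝ) : ℂ) *
                SHp d α Λ (n - 2 * m) (-(((n : ℝ) + d) / α)) u)) (g x : ℂ) := by
  have h := density_term_eq hd (by linarith : 0 < α) hc0 hc ‖x‖ u
  simp only [← hx] at h
  simpa only [h] using hasSum_density hd hα hc0 hc hg x

lemma norm_Vfun_cpow_le {c : ℝ} (hc0 : 0 < c) (hc : ∀ u : Sph d, c ≤ (Vfun d α Λ u).re)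
    {p : ℝ} (hp : p ≤ 0) (u : Sph d) : ‖Vfun d α Λ u ^ (p : ℂ)‖ ≤ c ^ p := by
  have hV : 0 < (Vfun d α Λ u).re := hc0.trans_le (hc u)
  have hV0 : Vfun d α Λ u ≠ 0 := fun h => by simp [h] at hV
  rw [Complex.norm_cpow_of_ne_zero hV0]
  simp only [Complex.ofReal_re, Complex.ofReal_im, mul_zero, Real.exp_zero, div_one]
  exact Real.rpow_le_rpow_of_nonpos hc0 ((hc u).trans (Complex.re_le_norm _)) hp

lemma norm_SHp_le (hd : 2 ≤ d) {c : ℝ} (hc0 : 0 < c)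
    (hc : ∀ u : Sph d, c ≤ (Vfun d α Λ u).re) {p : ℝ} (hp : p ≤ 0) (j : ℕ) (u : Sph d) :
    ‖SHp d α Λ j p u‖ ≤
      (sphereArea d)⁻¹ * ((2 * d) ^ j * c ^ p * (ωd d).real Set.univ) := by
  rw [SHp, norm_mul, norm_pow, norm_neg, Complex.norm_I, one_pow, one_mul,
    projC_eq_integral_zonal, norm_mul, norm_inv, Complex.norm_real,
    Real.norm_of_nonneg (sphereArea_pos hd).le]
  refine mul_le_mul_of_nonneg_left ?_ (inv_nonneg.2 (sphereArea_pos hd).le)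
  refine norm_integral_le_of_norm_le_const (Eventually.of_forall fun v => ?_)
  rw [norm_mul, Complex.norm_real]
  exact mul_le_mul (abs_zonal_le d hd _ (abs_inner_sphere_le u v) j)
    (norm_Vfun_cpow_le hc0 hc hp v) (norm_nonneg _) (by positivity)

lemma factorial_mul_Gamma_le (hd : 2 ≤ d) (k : ℕ) :
    (Nat.factorial k : ℝ) * Real.Gamma ((d : ℝ) / 2) ≤ Real.Gamma ((k : ℝ) + (d : ℝ) / 2) := by
  have hd' : (2 : ℝ) ≤ d := by exact_mod_cast hd
  induction k with
  | zero => simp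
  | succ k ih =>
    have h1 : ((k + 1 : ℕ) : ℝ) + (d : ℝ) / 2 = (k + (d : ℝ) / 2) + 1 := by push_cast; ring
    have hk : (0 : ℝ) ≤ k := by positivity
    rw [h1, Real.Gamma_add_one (by linarith), Nat.factorial_succ]
    have hG := (Real.Gamma_pos_of_pos (show (0 : ℝ) < d / 2 by linarith)).le
    push_cast
    rw [mul_assoc]
    exact mul_le_mul (by linarith) ih (by positivity) (by linarith)

lemma one_div_factorial_mul_Gamma_le (hd : 2 ≤ d) {m n : ℕ} (h : m ≤ n) :
    1 / ((Nat.factorial m : ℝ) * Real.Gamma ((n : ℝ) - m + (d : ℝ) / 2)) ≤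
      (Real.Gamma ((d : ℝ) / 2))⁻¹ * (n.choose m / Nat.factorial n) := by
  have hd' : (2 : ℝ) ≤ d := by exact_mod_cast hd
  have hG := Real.Gamma_pos_of_pos (show (0 : ℝ) < d / 2 by linarith)
  have h1 := factorial_mul_Gamma_le hd (n - m)
  rw [Nat.cast_sub h] at h1
  rw [Nat.cast_choose ℝ h]
  have e : (Real.Gamma ((d : ℝ) / 2))⁻¹ *
      ((Nat.factorial n : ℝ) / (Nat.factorial m * Nat.factorial (n - m)) / Nat.factorial n) =
      1 / ((Nat.factorial m : ℝ) * (Nat.factorial (n - m) * Real.Gamma ((d : ℝ) / 2))) := by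
    field_simp
  rw [e]
  gcongr

/-- The terms of the expansion are dominated, on `‖x‖ ≤ M`, by a summable sequence. -/
lemma exists_summable_bound (hd : 2 ≤ d) (hα : 1 < α)
    {c : ℝ} (hc0 : 0 < c) (hc : ∀ u : Sph d, c ≤ (Vfun d α Λ u).re) {M : ℝ} (hM : 0 < M) :
    ∃ b : ℕ → ℝ, Summable b ∧
      ∀ (n : ℕ) (x : Ed d) (u : Sph d), ‖x‖ ≤ M →
        ∑ m ∈ Finset.range (n / 2 + 1),
          ‖((Real.Gamma (((n : ℝ) + d) / α) * (‖x‖ / 2) ^ n : ℝ) : ℂ) *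
            ((((-1 : ℝ) ^ m / ((Nat.factorial m : ℝ) *
                Real.Gamma ((n : ℝ) - m + (d : ℝ) / 2)) : ℝ) : ℂ) *
              SHp d α Λ (n - 2 * m) (-(((n : ℝ) + d) / α)) u)‖ ≤ b n := by
  have hα0 : 0 < α := by linarith
  have hd' : (2 : ℝ) ≤ d := by exact_mod_cast hd
  have hG := Real.Gamma_pos_of_pos (show (0 : ℝ) < d / 2 by linarith)
  set D := (sphereArea d)⁻¹ * (c ^ (-(d : ℝ) / α) * (ωd d).real Set.univ) *
    (Real.Gamma ((d : ℝ) / 2))⁻¹ with hD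
  have hA := sphereArea_pos hd
  have hD0 : 0 ≤ D := by positivity
  refine ⟨_, (summable_Gamma_mul_pow_div_factorial hα d (by omega)
    (K := M * (2 * d) * c ^ (-1 / α)) (by positivity)).mul_left D, fun n x u hx => ?_⟩
  have hGn : 0 ≤ Real.Gamma (((n : ℝ) + d) / α) := Real.Gamma_nonneg_of_nonneg (by positivity)
  have hp : -(((n : ℝ) + d) / α) ≤ 0 := by
    have : 0 ≤ ((n : ℝ) + d) / α := by positivity
    linarith
  have hterm : ∀ m ∈ Finset.range (n / 2 + 1),
      ‖((Real.Gamma (((n : ℝ) + d) / α) * (‖x‖ / 2) ^ n : ℝ) : ℂ) *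
        ((((-1 : ℝ) ^ m / ((Nat.factorial m : ℝ) *
            Real.Gamma ((n : ℝ) - m + (d : ℝ) / 2)) : ℝ) : ℂ) *
          SHp d α Λ (n - 2 * m) (-(((n : ℝ) + d) / α)) u)‖ ≤
      D * (Real.Gamma (((n : ℝ) + d) / α) * (M * (2 * d) * c ^ (-1 / α)) ^ n /
        Nat.factorial n) * (n.choose m / 2 ^ n) := by
    intro m hm
    have hm : 2 * m ≤ n := by have := Finset.mem_range.1 hm; omega
    have hmn : (m : ℝ) ≤ n := by exact_mod_cast (by omega : m ≤ n)
    have hGm := Real.Gamma_pos_of_pos (show 0 < (n : ℝ) - m + d / 2 by linarith)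
    have hS := norm_SHp_le hd hc0 hc hp (n - 2 * m) u
    rw [← neg_div, rpow_neg_add_div hc0] at hS
    have hpow : (2 * (d : ℝ)) ^ (n - 2 * m) ≤ (2 * d) ^ n :=
      pow_le_pow_right₀ (by linarith) (Nat.sub_le _ _)
    rw [norm_mul, norm_mul, Complex.norm_real, Complex.norm_real, norm_div, norm_pow, norm_neg,
      norm_one, one_pow, Real.norm_of_nonneg (by positivity : 0 ≤
        (Nat.factorial m : ℝ) * Real.Gamma ((n : ℝ) - m + (d : ℝ) / 2)),
      Real.norm_of_nonneg (by positivity), ← neg_div]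
    calc _ ≤ (Real.Gamma (((n : ℝ) + d) / α) * (M / 2) ^ n) *
          (((Real.Gamma ((d : ℝ) / 2))⁻¹ * (n.choose m / Nat.factorial n)) *
            ((sphereArea d)⁻¹ * ((2 * d) ^ n * (c ^ (-(d : ℝ) / α) * (c ^ (-1 / α)) ^ n) *
              (ωd d).real Set.univ))) := by
          gcongr
          · exact one_div_factorial_mul_Gamma_le hd (by omega)
          · exact hS.trans (by gcongr)
      _ = _ := by
          rw [hD, div_pow, mul_pow (M * _), mul_pow M]
          ring
  have hchoose : ∑ m ∈ Finset.range (n / 2 + 1), (n.choose m / 2 ^ n : ℝ) ≤ 1 := by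
    rw [← Finset.sum_div, div_le_one (by positivity)]
    have : ∑ m ∈ Finset.range (n / 2 + 1), n.choose m ≤ 2 ^ n := by
      rw [← Nat.sum_range_choose]
      exact Finset.sum_le_sum_of_subset (Finset.range_subset_range.2 (by omega))
    exact_mod_cast this
  refine (Finset.sum_le_sum hterm).trans ?_
  rw [← Finset.mul_sum]
  exact mul_le_of_le_one_right (by positivity) hchoose

end Zonal

section Density
open scoped FourierTransform ContDiff
variable {d : ℕ} {α : ℝ} {Λ : Measure (Sph d)}

lemma IsDensityOf.eq_fourier {g : Ed d → ℝ} (hg : IsDensityOf d α Λ g) (x : Ed d) :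
    (g x : ℂ) = 𝓕 (fun ξ : Ed d => Complex.exp (-charExp d α Λ ((2 * π) • ξ))) x := by
  rw [hg x, Real.fourier_eq']
  have h := Measure.integral_comp_smul (volume : Measure (Ed d))
    (fun z => Complex.exp (-(Complex.I * (⟪x, z⟫ : ℂ))) * Complex.exp (-charExp d α Λ z)) (2 * π)
  rw [finrank_Ed, abs_of_pos (by positivity), Complex.real_smul] at h
  rw [← h]
  refine integral_congr_ae (Eventually.of_forall fun ξ => ?_)
  simp only [real_inner_smul_right, smul_eq_mul, real_inner_comm ξ x]
  push_cast
  ring_nf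

lemma continuous_cexp_neg_charExp [IsFiniteMeasure Λ] (hα : 0 < α) :
    Continuous fun ξ : Ed d => Complex.exp (-charExp d α Λ ((2 * π) • ξ)) := by
  have := continuous_charExp (d := d) (Λ := Λ) hα
  fun_prop

lemma integrable_cexp_neg_charExp_smul [IsFiniteMeasure Λ] (hd : 2 ≤ d) (hα : 0 < α)
    {c : ℝ} (hc0 : 0 < c) (hc : ∀ u : Sph d, c ≤ (Vfun d α Λ u).re) :
    Integrable fun ξ : Ed d => Complex.exp (-charExp d α Λ ((2 * π) • ξ)) :=
  (integrable_cexp_neg_charExp hd hα hc0 hc).comp_smul (by positivity)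

lemma IsDensityOf.continuous [IsFiniteMeasure Λ] (hd : 2 ≤ d) (hα : 0 < α)
    {c : ℝ} (hc0 : 0 < c) (hc : ∀ u : Sph d, c ≤ (Vfun d α Λ u).re)
    {g : Ed d → ℝ} (hg : IsDensityOf d α Λ g) : Continuous g := by
  have h : Continuous (𝓕 (fun ξ : Ed d => Complex.exp (-charExp d α Λ ((2 * π) • ξ)))) :=
    VectorFourier.fourierIntegral_continuous Real.continuous_fourierChar
      (by exact continuous_inner) (integrable_cexp_neg_charExp_smul hd hα hc0 hc)
  have hre : g = fun x =>
      (𝓕 (fun ξ : Ed d => Complex.exp (-charExp d α Λ ((2 * π) • ξ))) x).re :=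
    funext fun x => by rw [← hg.eq_fourier, Complex.ofReal_re]
  rw [hre]
  exact Complex.continuous_re.comp h

lemma integral_eq_integral_mul_density [IsFiniteMeasure Λ] (hd : 2 ≤ d) (hα : 0 < α)
    {c : ℝ} (hc0 : 0 < c) (hc : ∀ u : Sph d, c ≤ (Vfun d α Λ u).re)
    {g : Ed d → ℝ} (hg : IsDensityOf d α Λ g) {μ : Measure (Ed d)} [IsFiniteMeasure μ]
    (hμ : IsStableChar d α Λ μ) {f : Ed d → ℂ} (hf : Continuous f) (hfi : Integrable f)
    (hFf : Integrable (𝓕 f)) :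
    ∫ x, f x ∂μ = ∫ x, f x * (g x : ℂ) := by
  have hFc : Continuous (𝓕 f) :=
    VectorFourier.fourierIntegral_continuous Real.continuous_fourierChar
      (by exact continuous_inner) hfi
  have hinv : ∀ x, f x = ∫ ξ, Complex.exp (((2 * π * ⟪ξ, x⟫ : ℝ) : ℂ) * Complex.I) • 𝓕 f ξ :=
    fun x => by rw [← Real.fourierInv_eq', hf.fourierInv_fourier_eq hfi hFf]
  have hint : Integrable (fun p : Ed d × Ed d =>
      Complex.exp (((2 * π * ⟪p.2, p.1⟫ : ℝ) : ℂ) * Complex.I) • 𝓕 f p.2) (μ.prod volume) := by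
    refine (hFf.norm.comp_snd μ).mono' (Continuous.aestronglyMeasurable (by fun_prop))
      (Eventually.of_forall fun p => ?_)
    rw [norm_smul, Complex.norm_exp_ofReal_mul_I, one_mul]
  calc ∫ x, f x ∂μ
      = ∫ x, (∫ ξ, Complex.exp (((2 * π * ⟪ξ, x⟫ : ℝ) : ℂ) * Complex.I) • 𝓕 f ξ) ∂μ :=
        integral_congr_ae (Eventually.of_forall hinv)
    _ = ∫ ξ, (∫ x, Complex.exp (((2 * π * ⟪ξ, x⟫ : ℝ) : ℂ) * Complex.I) • 𝓕 f ξ ∂μ) :=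
        integral_integral_swap hint
    _ = ∫ ξ, 𝓕 f ξ • Complex.exp (-charExp d α Λ ((2 * π) • ξ)) := by
        refine integral_congr_ae (Eventually.of_forall fun ξ => ?_)
        beta_reduce
        rw [integral_smul_const, ← hμ ((2 * π) • ξ), smul_eq_mul, smul_eq_mul, mul_comm]
        congr 1
        refine integral_congr_ae (Eventually.of_forall fun x => ?_)
        simp only [real_inner_smul_left, mul_comm]
    _ = ∫ x, f x • 𝓕 (fun ξ : Ed d => Complex.exp (-charExp d α Λ ((2 * π) • ξ))) x := by
        have h := VectorFourier.integral_fourierIntegral_smul_eq_flip (L := innerₗ (Ed d))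
          (μ := volume) (ν := volume) Real.continuous_fourierChar continuous_inner hfi
          (integrable_cexp_neg_charExp_smul hd hα hc0 hc)
        rw [flip_innerₗ] at h
        exact h
    _ = _ := by simp only [← hg.eq_fourier, smul_eq_mul]

lemma density_nonneg [IsFiniteMeasure Λ] (hd : 2 ≤ d) (hα : 0 < α)
    {c : ℝ} (hc0 : 0 < c) (hc : ∀ u : Sph d, c ≤ (Vfun d α Λ u).re)
    {g : Ed d → ℝ} (hg : IsDensityOf d α Λ g) {μ : Measure (Ed d)} [IsFiniteMeasure μ]
    (hμ : IsStableChar d α Λ μ) (x : Ed d) : 0 ≤ g x := by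
  by_contra! hx
  have hgc := hg.continuous hd hα hc0 hc
  obtain ⟨ε, hε, hball⟩ := Metric.isOpen_iff.1 (isOpen_lt hgc continuous_const) x hx
  let b : ContDiffBump x := ⟨ε / 2, ε, by linarith, by linarith⟩
  have hbs : HasCompactSupport fun y => (b y : ℂ) :=
    b.hasCompactSupport.comp_left (g := ((↑) : ℝ → ℂ)) Complex.ofReal_zero
  have hbc : ContDiff ℝ ∞ fun y => (b y : ℂ) := Complex.ofRealCLM.contDiff.comp b.contDiff
  have h := integral_eq_integral_mul_density hd hα hc0 hc hg hμ
    (f := hbs.toSchwartzMap hbc) (SchwartzMap.continuous _) (SchwartzMap.integrable _)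
    (by rw [← SchwartzMap.fourier_coe]; exact SchwartzMap.integrable _)
  simp only [HasCompactSupport.toSchwartzMap_toFun, ← Complex.ofReal_mul,
    integral_complex_ofReal] at h
  have h := Complex.ofReal_injective h
  have h1 : 0 ≤ ∫ y, b y ∂μ := integral_nonneg fun y => b.nonneg
  have h2 : 0 < ∫ y, -(b y * g y) := by
    refine Continuous.integral_pos_of_hasCompactSupport_nonneg_nonzero
      (b.continuous.mul hgc).neg ?_ ?_ (x := x) ?_
    · exact (b.hasCompactSupport.mul_right (f' := g)).neg
    · intro y
      by_cases hy : y ∈ Metric.ball x ε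
      · have : g y < 0 := hball hy
        have := b.nonneg (x := y)
        simp only [Pi.zero_apply]
        nlinarith
      · have : b y = 0 := b.zero_of_le_dist (by simpa using hy)
        simp [this]
    · have : b x = 1 := b.eventuallyEq_one.eq_of_nhds
      simp [this, hx.ne]
  rw [integral_neg] at h2
  linarith

lemma density_integrable [IsFiniteMeasure Λ] (hd : 2 ≤ d) (hα : 0 < α)
    {c : ℝ} (hc0 : 0 < c) (hc : ∀ u : Sph d, c ≤ (Vfun d α Λ u).re)
    {g : Ed d → ℝ} (hg : IsDensityOf d α Λ g) {μ : Measure (Ed d)} [IsProbabilityMeasure μ]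
    (hμ : IsStableChar d α Λ μ) : Integrable g := by
  have hgc := hg.continuous hd hα hc0 hc
  have hg0 := density_nonneg hd hα hc0 hc hg hμ
  refine ⟨hgc.aestronglyMeasurable, ?_⟩
  have hgauss : ∀ b : ℝ, 0 < b →
      ∫⁻ x, ENNReal.ofReal (Real.exp (-b * ‖x‖ ^ 2) * g x) ≤ 1 := by
    intro b hb
    have hb' : 0 < (b : ℂ).re := hb
    have hbi : 0 < ((π ^ 2 / b : ℝ) : ℂ).re := by
      rw [Complex.ofReal_re]; positivity
    have hgi : ∀ b : ℂ, 0 < b.re →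
        Integrable fun x : Ed d => Complex.exp (-b * ‖x‖ ^ 2) := fun b hb => by
      simpa using GaussianFourier.integrable_cexp_neg_mul_sq_norm_add hb 0 (0 : Ed d)
    have h := integral_eq_integral_mul_density hd hα hc0 hc hg hμ
      (f := fun x : Ed d => Complex.exp (-(b : ℂ) * ‖x‖ ^ 2)) (by fun_prop) (hgi b hb') (by
        have hF : 𝓕 (fun x : Ed d => Complex.exp (-(b : ℂ) * ‖x‖ ^ 2)) = fun w =>
            (π / b) ^ (Module.finrank ℝ (Ed d) / 2 : ℂ) *
              Complex.exp (-((π ^ 2 / b : ℝ) : ℂ) * ‖w‖ ^ 2) := by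
          funext w
          rw [fourier_gaussian_innerProductSpace hb']
          congr 2
          push_cast
          ring
        rw [hF]
        exact (hgi _ hbi).const_mul _)
    have hcast : ∀ x : Ed d, Complex.exp (-(b : ℂ) * ‖x‖ ^ 2) =
        ((Real.exp (-b * ‖x‖ ^ 2) : ℝ) : ℂ) := fun x => by push_cast; rfl
    simp only [hcast, ← Complex.ofReal_mul, integral_complex_ofReal] at h
    have h := Complex.ofReal_injective h
    have hb1 : ∀ x : Ed d, Real.exp (-b * ‖x‖ ^ 2) ≤ 1 := fun x =>
      Real.exp_le_one_iff.2 (by have : 0 ≤ b * ‖x‖ ^ 2 := by positivity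
                                linarith)
    have h1 : ∫ x, Real.exp (-b * ‖x‖ ^ 2) ∂μ ≤ 1 := by
      have := integral_mono_of_nonneg (μ := μ) (Eventually.of_forall fun x => (Real.exp_pos _).le)
        (integrable_const (1 : ℝ)) (Eventually.of_forall hb1)
      simpa using this
    have hint : Integrable fun x : Ed d => Real.exp (-b * ‖x‖ ^ 2) * g x := by
      have hgn : ∀ x, ‖g x‖ ≤ ∫ ξ, ‖Complex.exp (-charExp d α Λ ((2 * π) • ξ))‖ := fun x => by
        rw [← Complex.norm_real, hg.eq_fourier]
        exact VectorFourier.norm_fourierIntegral_le_integral_norm _ _ _ _ _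
      refine Integrable.mul_bdd (c := ∫ ξ, ‖Complex.exp (-charExp d α Λ ((2 * π) • ξ))‖) ?_
        hgc.aestronglyMeasurable (Eventually.of_forall hgn)
      have := (hgi b hb').re
      simpa only [hcast, RCLike.re_to_complex, Complex.ofReal_re] using this
    rw [← ofReal_integral_eq_lintegral_ofReal hint
      (Eventually.of_forall fun x => mul_nonneg (Real.exp_pos _).le (hg0 x)), ← h]
    exact ENNReal.ofReal_le_one.2 h1
  have hlim := lintegral_tendsto_of_tendsto_of_monotone (μ := (volume : Measure (Ed d)))
    (f := fun (n : ℕ) x => ENNReal.ofReal (Real.exp (-(1 / ((n : ℝ) + 1)) * ‖x‖ ^ 2) * g x))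
    (F := fun x => ENNReal.ofReal (g x))
    (fun n => by have := hgc.measurable; fun_prop)
    (Eventually.of_forall fun x m n hmn => by
      have : (m : ℝ) ≤ n := by exact_mod_cast hmn
      have := hg0 x
      dsimp only
      gcongr)
    (Eventually.of_forall fun x => by
      refine ENNReal.tendsto_ofReal ?_
      have h1 : Tendsto (fun n : ℕ => Real.exp (-(1 / ((n : ℝ) + 1)) * ‖x‖ ^ 2) * g x) atTop
          (𝓝 (Real.exp (-0 * ‖x‖ ^ 2) * g x)) :=
        ((Real.continuous_exp.tendsto _).comp
          (tendsto_one_div_add_atTop_nhds_zero_nat.neg.mul_const _)).mul_const _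
      simpa using h1)
  have hle := le_of_tendsto' hlim fun n => hgauss _ (by positivity)
  rw [hasFiniteIntegral_iff_ofReal (Eventually.of_forall hg0)]
  exact hle.trans_lt ENNReal.one_lt_top

/-- A nondegenerate stable law is absolutely continuous, with density given by Fourier inversion. -/
theorem eq_withDensity_density [IsFiniteMeasure Λ] (hd : 2 ≤ d) (hα : 0 < α)
    {c : ℝ} (hc0 : 0 < c) (hc : ∀ u : Sph d, c ≤ (Vfun d α Λ u).re)
    {g : Ed d → ℝ} (hg : IsDensityOf d α Λ g) {μ : Measure (Ed d)} [IsProbabilityMeasure μ]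
    (hμ : IsStableChar d α Λ μ) :
    μ = (volume : Measure (Ed d)).withDensity fun x => ENNReal.ofReal (g x) := by
  have hgc := hg.continuous hd hα hc0 hc
  have hg0 := density_nonneg hd hα hc0 hc hg hμ
  have hgi := density_integrable hd hα hc0 hc hg hμ
  have : IsFiniteMeasure ((volume : Measure (Ed d)).withDensity fun x => ENNReal.ofReal (g x)) :=
    isFiniteMeasure_withDensity_ofReal hgi.2
  refine Measure.ext_of_charFun (funext fun t => ?_)
  have h1 : charFun μ t = Complex.exp (-charExp d α Λ t) := by
    rw [← hμ, charFun_apply]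
    refine integral_congr_ae (Eventually.of_forall fun x => ?_)
    simp only [mul_comm, real_inner_comm]
  have hF : 𝓕 (fun ξ : Ed d => Complex.exp (-charExp d α Λ ((2 * π) • ξ))) =
      fun x => (g x : ℂ) := funext fun x => (hg.eq_fourier x).symm
  have hinv := congrFun (Continuous.fourierInv_fourier_eq (continuous_cexp_neg_charExp hα)
    (integrable_cexp_neg_charExp_smul hd hα hc0 hc) (by rw [hF]; exact hgi.ofReal))
    ((2 * π)⁻¹ • t)
  rw [hF, Real.fourierInv_eq', smul_smul, mul_inv_cancel₀ (by positivity), one_smul] at hinv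
  rw [h1, ← hinv, charFun_apply]
  have hmeas : Measurable fun x => Real.toNNReal (g x) := hgc.measurable.real_toNNReal
  refine Eq.symm ((integral_withDensity_eq_integral_smul hmeas _).trans ?_)
  refine integral_congr_ae (Eventually.of_forall fun x => ?_)
  simp only [NNReal.smul_def, Real.coe_toNNReal _ (hg0 x), Complex.real_smul, smul_eq_mul,
    real_inner_smul_right]
  rw [mul_comm, ← mul_assoc (2 * π), mul_inv_cancel₀ (by positivity), one_mul]

end Density

section Moments
variable {d : ℕ}

lemma integral_pow_mul_exp_neg_sq_odd (k : ℕ) :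
    ∫ t : ℝ, t ^ (2 * k + 1) * Real.exp (-t ^ 2) = 0 := by
  have h := integral_neg_eq_self (fun t : ℝ => t ^ (2 * k + 1) * Real.exp (-t ^ 2)) volume
  simp only [Odd.neg_pow (odd_two_mul_add_one k), neg_sq, neg_mul, integral_neg] at h
  linarith

lemma integral_pow_mul_exp_neg_sq_even (k : ℕ) :
    ∫ t : ℝ, t ^ (2 * k) * Real.exp (-t ^ 2) = Real.Gamma ((k : ℝ) + 1 / 2) := by
  have h := integral_comp_abs (f := fun t : ℝ => t ^ (2 * k) * Real.exp (-t ^ 2))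
  simp only [sq_abs, (even_two_mul k).pow_abs] at h
  have h2 := integral_pow_mul_exp_neg_mul_rpow (α := 2) (c := 1) two_pos one_pos (2 * k)
  simp only [Real.rpow_two, Real.one_rpow, neg_mul, one_mul] at h2
  rw [h, h2]
  push_cast
  ring_nf

lemma integral_inner_pow_mul_gaussian (hd : 2 ≤ d) (v : Sph d) (k : ℕ) :
    ∫ z : Ed d, ⟪z, (v : Ed d)⟫ ^ k * Real.exp (-‖z‖ ^ 2) =
      (∫ t : ℝ, t ^ k * Real.exp (-t ^ 2)) * √π ^ (d - 1) := by
  let i₀ : Fin d := ⟨0, by omega⟩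
  obtain ⟨b, hb⟩ := Orthonormal.exists_orthonormalBasis_extension_of_card_eq (𝕜 := ℝ)
    (E := Ed d) (ι := Fin d) (by simp) (v := fun _ => (v : Ed d)) (s := {i₀})
    (by
      rw [orthonormal_iff_ite]
      rintro ⟨i, rfl⟩ ⟨j, rfl⟩
      simp)
  have hb0 : b i₀ = v := hb i₀ rfl
  have hgauss : ∫ t : ℝ, Real.exp (-t ^ 2) = √π := by
    simpa using integral_gaussian 1
  let F : Ed d → ℝ := fun y => y i₀ ^ k * Real.exp (-‖y‖ ^ 2)
  calc ∫ z : Ed d, ⟪z, (v : Ed d)⟫ ^ k * Real.exp (-‖z‖ ^ 2)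
      = ∫ z : Ed d, F (b.repr z) := by
        refine integral_congr_ae (Eventually.of_forall fun z => ?_)
        simp only [F, b.repr_apply_apply, hb0, LinearIsometryEquiv.norm_map, real_inner_comm z]
    _ = ∫ y : Ed d, F y :=
        b.measurePreserving_repr.integral_comp b.repr.toMeasurableEquiv.measurableEmbedding F
    _ = ∫ y : Fin d → ℝ, ∏ i, ((if i = i₀ then y i ^ k else 1) * Real.exp (-y i ^ 2)) := by
        rw [← (PiLp.volume_preserving_toLp (Fin d)).integral_comp
          (MeasurableEquiv.toLp 2 _).measurableEmbedding]
        refine integral_congr_ae (Eventually.of_forall fun y => ?_)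
        simp only [F, EuclideanSpace.real_norm_sq_eq, Finset.prod_mul_distrib, ← Real.exp_sum,
          Finset.prod_ite_eq', Finset.mem_univ, if_true, Finset.sum_neg_distrib]
    _ = ∏ i : Fin d, ∫ t : ℝ, (if i = i₀ then t ^ k else 1) * Real.exp (-t ^ 2) :=
        integral_fintype_prod_volume_eq_prod
          fun i t => (if i = i₀ then t ^ k else 1) * Real.exp (-t ^ 2)
    _ = _ := by
        rw [← Finset.mul_prod_erase _ _ (Finset.mem_univ i₀)]
        have : ∀ i ∈ Finset.univ.erase i₀,
            ∫ t : ℝ, (if i = i₀ then t ^ k else 1) * Real.exp (-t ^ 2) = √π := fun i hi => by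
          simp [Finset.ne_of_mem_erase hi, hgauss]
        rw [Finset.prod_congr rfl this]
        simp

/-- Moments of linear functionals on the sphere, in terms of one-dimensional Gaussian moments. -/
lemma integral_inner_sphere_pow (hd : 2 ≤ d) (v : Sph d) (k : ℕ) :
    ∫ u : Sph d, (⟪(u : Ed d), (v : Ed d)⟫ : ℂ) ^ k ∂(ωd d) =
      ((2 / Real.Gamma (((k : ℝ) + d) / 2) *
        ((∫ t : ℝ, t ^ k * Real.exp (-t ^ 2)) * √π ^ (d - 1)) : ℝ) : ℂ) := by
  have hint : Integrable fun z : Ed d => ⟪z, (v : Ed d)⟫ ^ k * Real.exp (-‖z‖ ^ 2) := by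
    have hc : Continuous fun z : Ed d => ⟪z, (v : Ed d)⟫ ^ k * Real.exp (-‖z‖ ^ 2) := by fun_prop
    refine (integrable_norm_pow_mul_exp (α := 2) hd two_pos one_pos k).mono'
      hc.aestronglyMeasurable (Eventually.of_forall fun z => ?_)
    have h := abs_real_inner_le_norm z (v : Ed d)
    rw [norm_sphere, mul_one] at h
    rw [norm_mul, norm_pow, Real.norm_eq_abs, Real.norm_eq_abs, Real.abs_exp, Real.rpow_two,
      neg_mul, one_mul]
    gcongr
  have hd1 : ((d - 1 : ℕ) : ℝ) = d - 1 := by rw [Nat.cast_sub (by omega)]; simp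
  have hG : 0 < Real.Gamma (((k : ℝ) + d) / 2) := Real.Gamma_pos_of_pos (by positivity)
  have hintc : Integrable fun z : Ed d =>
      ((⟪z, (v : Ed d)⟫ ^ k * Real.exp (-‖z‖ ^ 2) : ℝ) : ℂ) := hint.ofReal
  have h := integral_polar hd hintc
  have hr : ∀ u : Sph d, ∫ r in Set.Ioi (0 : ℝ), ((r ^ (d - 1) : ℝ) : ℂ) *
      ((⟪r • (u : Ed d), (v : Ed d)⟫ ^ k * Real.exp (-‖r • (u : Ed d)‖ ^ 2) : ℝ) : ℂ) =
      ((Real.Gamma (((k : ℝ) + d) / 2) / 2 : ℝ) : ℂ) *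
        (⟪(u : Ed d), (v : Ed d)⟫ : ℂ) ^ k := fun u => by
    have h2 := integral_pow_mul_exp_neg_mul_rpow (α := 2) (c := 1) two_pos one_pos (d - 1 + k)
    simp only [Real.rpow_two, Real.one_rpow, neg_mul, one_mul, Nat.cast_add, hd1,
      show (d : ℝ) - 1 + k + 1 = k + d by ring] at h2
    rw [← Complex.ofReal_pow, ← Complex.ofReal_mul, div_eq_inv_mul, ← one_div, ← h2,
      ← integral_mul_const, ← integral_complex_ofReal]
    refine integral_congr_ae (Eventually.of_forall fun r => ?_)
    simp only [real_inner_smul_left, norm_smul, norm_sphere, mul_one, Real.norm_eq_abs, sq_abs]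
    push_cast
    ring
  rw [integral_complex_ofReal, integral_inner_pow_mul_gaussian hd] at h
  simp only [hr, integral_const_mul] at h
  rw [Complex.ofReal_mul, h, ← mul_assoc, ← Complex.ofReal_mul, div_mul_div_comm, mul_comm,
    mul_comm 2, div_self (by positivity), Complex.ofReal_one, mul_one]

lemma integral_inner_sphere_pow_odd (hd : 2 ≤ d) (v : Sph d) (k : ℕ) :
    ∫ u : Sph d, (⟪(u : Ed d), (v : Ed d)⟫ : ℂ) ^ (2 * k + 1) ∂(ωd d) = 0 := by
  rw [integral_inner_sphere_pow hd, integral_pow_mul_exp_neg_sq_odd]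
  simp

lemma Gamma_nat_add_half_eq (k : ℕ) :
    Real.Gamma ((k : ℝ) + 1 / 2) = ((2 * k).factorial : ℝ) * √π / (4 ^ k * k.factorial) := by
  induction k with
  | zero => simpa using Real.Gamma_one_half_eq
  | succ k ih =>
    rw [show ((k + 1 : ℕ) : ℝ) + 1 / 2 = ((k : ℝ) + 1 / 2) + 1 by push_cast; ring,
      Real.Gamma_add_one (by positivity), ih, show 2 * (k + 1) = 2 * k + 1 + 1 by ring]
    simp only [Nat.factorial_succ]
    push_cast
    field_simp
    ring

lemma integral_inner_sphere_pow_even (hd : 2 ≤ d) (v : Sph d) (k : ℕ) :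
    ∫ u : Sph d, (⟪(u : Ed d), (v : Ed d)⟫ : ℂ) ^ (2 * k) ∂(ωd d) =
      ((2 * π ^ ((d : ℝ) / 2) * (2 * k).factorial /
        (4 ^ k * k.factorial * Real.Gamma ((k : ℝ) + d / 2)) : ℝ) : ℂ) := by
  rw [integral_inner_sphere_pow hd, integral_pow_mul_exp_neg_sq_even, Gamma_nat_add_half_eq]
  have hpi : π ^ ((d : ℝ) / 2) = √π * √π ^ (d - 1) := by
    rw [← pow_succ', Nat.sub_add_cancel (by omega), Real.sqrt_eq_rpow, ← Real.rpow_mul_natCast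
      Real.pi_pos.le]
    ring_nf
  rw [hpi, show (((2 * k : ℕ) : ℝ) + d) / 2 = k + d / 2 by push_cast; ring]
  congr 1
  field_simp

end Moments

section Radial
variable {d : ℕ} {α : ℝ} {Λ : Measure (Sph d)}

lemma integrable_inner_pow_mul_prod (n : ℕ) {f : Sph d → ℂ} (hf : Continuous f) :
    Integrable (fun p : Sph d × Sph d => (⟪(p.1 : Ed d), (p.2 : Ed d)⟫ : ℂ) ^ n * f p.2)
      ((ωd d).prod (ωd d)) := by
  have hc : Continuous fun p : Sph d × Sph d =>
      (⟪(p.1 : Ed d), (p.2 : Ed d)⟫ : ℂ) ^ n * f p.2 := by fun_prop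
  exact hc.integrable_of_hasCompactSupport (HasCompactSupport.of_compactSpace _)

/-- Averaging a power of the inner product kernel over the sphere. -/
lemma integral_integral_inner_pow_mul (n : ℕ) {f : Sph d → ℂ} (hf : Continuous f) {M : ℂ}
    (hM : ∀ v : Sph d, ∫ u : Sph d, (⟪(u : Ed d), (v : Ed d)⟫ : ℂ) ^ n ∂(ωd d) = M) :
    ∫ u : Sph d, (∫ v : Sph d, (⟪(u : Ed d), (v : Ed d)⟫ : ℂ) ^ n * f v ∂(ωd d)) ∂(ωd d) =
      M * ∫ v, f v ∂(ωd d) := by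
  rw [integral_integral_swap (integrable_inner_pow_mul_prod n hf)]
  simp only [integral_mul_const, hM, integral_const_mul]

lemma hasSum_integral_sphere_density [IsFiniteMeasure Λ] (hd : 2 ≤ d) (hα : 1 < α)
    {c : ℝ} (hc0 : 0 < c) (hc : ∀ u : Sph d, c ≤ (Vfun d α Λ u).re)
    {g : Ed d → ℝ} (hg : IsDensityOf d α Λ g) {r : ℝ} (hr : 0 < r) :
    HasSum (fun n : ℕ => ((((2 * π) ^ d)⁻¹ : ℝ) : ℂ) *
      ((-Complex.I) ^ n / (Nat.factorial n : ℂ) *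
        (((Real.Gamma (((n : ℝ) + d) / α) / α : ℝ) : ℂ) * ((r : ℂ) ^ n *
        ∫ u : Sph d, (∫ v : Sph d, (⟪(u : Ed d), (v : Ed d)⟫ : ℂ) ^ n *
          Vfun d α Λ v ^ ((-(((n : ℝ) + d) / α) : ℝ) : ℂ) ∂(ωd d)) ∂(ωd d)))))
      ((∫ u : Sph d, g (r • (u : Ed d)) ∂(ωd d) : ℝ) : ℂ) := by
  have hα0 : 0 < α := by linarith
  have hVc : ∀ n : ℕ, Continuous fun v : Sph d =>
      Vfun d α Λ v ^ ((-(((n : ℝ) + d) / α) : ℝ) : ℂ) := fun n =>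
    continuous_Vfun_cpow hα0 hc0 hc _
  have hi : ∀ n : ℕ, Integrable (fun u : Sph d =>
      ∫ v : Sph d, (⟪(u : Ed d), (v : Ed d)⟫ : ℂ) ^ n *
        Vfun d α Λ v ^ ((-(((n : ℝ) + d) / α) : ℝ) : ℂ) ∂(ωd d)) (ωd d) := fun n =>
    (integrable_inner_pow_mul_prod n (hVc n)).integral_prod_left
  have hscale : ∀ (n : ℕ) (u : Sph d),
      ∫ v : Sph d, (⟪r • (u : Ed d), (v : Ed d)⟫ : ℂ) ^ n *
        Vfun d α Λ v ^ ((-(((n : ℝ) + d) / α) : ℝ) : ℂ) ∂(ωd d) =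
      (r : ℂ) ^ n * ∫ v : Sph d, (⟪(u : Ed d), (v : Ed d)⟫ : ℂ) ^ n *
        Vfun d α Λ v ^ ((-(((n : ℝ) + d) / α) : ℝ) : ℂ) ∂(ωd d) := fun n u => by
    rw [← integral_const_mul]
    refine integral_congr_ae (Eventually.of_forall fun v => ?_)
    simp only [real_inner_smul_left, Complex.ofReal_mul, mul_pow, mul_assoc]
  have hbound : ∀ (n : ℕ) (u : Sph d),
      ‖∫ v : Sph d, (⟪(u : Ed d), (v : Ed d)⟫ : ℂ) ^ n *
        Vfun d α Λ v ^ ((-(((n : ℝ) + d) / α) : ℝ) : ℂ) ∂(ωd d)‖ ≤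
      c ^ (-(d : ℝ) / α) * (c ^ (-1 / α)) ^ n * (ωd d).real Set.univ := fun n u => by
    refine norm_integral_le_of_norm_le_const (Eventually.of_forall fun v => ?_)
    rw [norm_mul, norm_pow, Complex.norm_real, Real.norm_eq_abs, ← rpow_neg_add_div hc0, neg_div]
    refine (mul_le_of_le_one_left (norm_nonneg _)
      (pow_le_one₀ (abs_nonneg _) (abs_inner_sphere_le u v))).trans
      (norm_Vfun_cpow_le hc0 hc ?_ v)
    have : 0 ≤ ((n : ℝ) + d) / α := by positivity
    linarith
  have h := hasSum_integral_of_summable_integral_norm (μ := ωd d)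
    (F := fun (n : ℕ) (u : Sph d) => ((((2 * π) ^ d)⁻¹ : ℝ) : ℂ) *
      ((-Complex.I) ^ n / (Nat.factorial n : ℂ) *
        (((Real.Gamma (((n : ℝ) + d) / α) / α : ℝ) : ℂ) * ((r : ℂ) ^ n *
        ∫ v : Sph d, (⟪(u : Ed d), (v : Ed d)⟫ : ℂ) ^ n *
          Vfun d α Λ v ^ ((-(((n : ℝ) + d) / α) : ℝ) : ℂ) ∂(ωd d)))))
    (fun n => ((((hi n).const_mul _).const_mul _).const_mul _).const_mul _) (by
      refine ((summable_Gamma_mul_pow_div_factorial hα d (by omega) (K := r * c ^ (-1 / α))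
        (by positivity)).mul_left (((2 * π) ^ d)⁻¹ / α * (c ^ (-(d : ℝ) / α) *
          (ωd d).real Set.univ) * (ωd d).real Set.univ)).of_nonneg_of_le
        (fun n => integral_nonneg fun z => norm_nonneg _) fun n => ?_
      have hG : 0 ≤ Real.Gamma (((n : ℝ) + d) / α) := Real.Gamma_nonneg_of_nonneg (by positivity)
      refine (Real.le_norm_self _).trans ((norm_integral_le_of_norm_le_const
        (C := ((2 * π) ^ d)⁻¹ * (1 / (n.factorial : ℝ) * (Real.Gamma (((n : ℝ) + d) / α) / α *
          (r ^ n * (c ^ (-(d : ℝ) / α) * (c ^ (-1 / α)) ^ n * (ωd d).real Set.univ)))))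
        (Eventually.of_forall fun u => ?_)).trans (le_of_eq ?_))
      · rw [norm_norm, norm_mul, norm_mul, norm_mul, norm_mul, Complex.norm_real,
          Complex.norm_real, Real.norm_of_nonneg (by positivity),
          Real.norm_of_nonneg (by positivity), norm_pow, Complex.norm_real,
          Real.norm_of_nonneg hr.le, norm_div, norm_pow, norm_neg, Complex.norm_I, one_pow,
          Complex.norm_natCast]
        gcongr
        exact hbound n u
      · rw [mul_pow]
        ring)
  simp only [integral_const_mul] at h
  simp only [← hscale, (hasSum_density hd hα hc0 hc hg _).tsum_eq, integral_complex_ofReal] at h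
  exact h

/-- The series for the density of the norm, summed to `r^{d-1}` times the spherical integral of
the density on the sphere of radius `r`. -/
lemma hasSum_radial_density [IsFiniteMeasure Λ] (hd : 2 ≤ d) (hα : 1 < α)
    {c : ℝ} (hc0 : 0 < c) (hc : ∀ u : Sph d, c ≤ (Vfun d α Λ u).re)
    {g : Ed d → ℝ} (hg : IsDensityOf d α Λ g) {r : ℝ} (hr : 0 < r) :
    HasSum (fun n : ℕ =>
      (((1 / (Real.pi ^ ((d : ℝ) / 2) * α)) * ((-1 : ℝ) ^ n *
            Real.Gamma ((2 * (n : ℝ) + d) / α) /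
            ((Nat.factorial n : ℝ) * Real.Gamma ((n : ℝ) + (d : ℝ) / 2))) *
          (r / 2) ^ (2 * n + d - 1) : ℝ) : ℂ) *
        ∫ u, (Vfun d α Λ u) ^ ((-((2 * (n : ℝ) + d) / α) : ℝ) : ℂ) ∂(ωd d))
      ((r ^ (d - 1) * ∫ u : Sph d, g (r • (u : Ed d)) ∂(ωd d) : ℝ) : ℂ) := by
  have hα0 : 0 < α := by linarith
  have hVc : ∀ n : ℕ, Continuous fun v : Sph d =>
      Vfun d α Λ v ^ ((-(((n : ℝ) + d) / α) : ℝ) : ℂ) := fun n =>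
    continuous_Vfun_cpow hα0 hc0 hc _
  have h := hasSum_integral_sphere_density hd hα hc0 hc hg hr
  have hinj : Function.Injective fun n : ℕ => 2 * n := fun m n h => by
    simpa using h
  rw [← hinj.hasSum_iff (fun n hn => ?_)] at h
  · rw [Complex.ofReal_mul]
    refine (h.mul_left ((r ^ (d - 1) : ℝ) : ℂ)).congr_fun fun n => ?_
    have hG : 0 < Real.Gamma ((n : ℝ) + d / 2) := Real.Gamma_pos_of_pos (by positivity)
    have hp := Real.rpow_pos_of_pos Real.pi_pos ((d : ℝ) / 2)
    simp only [Function.comp_apply]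
    rw [integral_integral_inner_pow_mul _ (hVc _)
      (fun v => integral_inner_sphere_pow_even hd v n)]
    have hI : (-Complex.I) ^ (2 * n) = (((-1 : ℝ) ^ n : ℝ) : ℂ) := by
      rw [pow_mul, neg_sq, Complex.I_sq]
      push_cast
      rfl
    rw [hI]
    simp only [Nat.cast_mul, Nat.cast_ofNat, ← mul_assoc, ← Complex.ofReal_pow,
      ← Complex.ofReal_natCast, ← Complex.ofReal_mul, ← Complex.ofReal_div]
    congr 2
    have hpow : (r / 2) ^ (2 * n + d - 1) = r ^ (d - 1) * r ^ (2 * n) * (2 / (4 ^ n * 2 ^ d)) := by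
      obtain ⟨e, rfl⟩ : ∃ e, d = e + 1 := ⟨d - 1, by omega⟩
      rw [show 2 * n + (e + 1) - 1 = 2 * n + e by omega, Nat.add_sub_cancel, div_pow,
        pow_add, pow_add 2, pow_mul 2, pow_succ 2 e]
      norm_num
      field_simp
    have hpi : π ^ d = π ^ ((d : ℝ) / 2) * π ^ ((d : ℝ) / 2) := by
      rw [← Real.rpow_add Real.pi_pos, ← Real.rpow_natCast]
      ring_nf
    rw [hpow, mul_pow 2 π, hpi]
    field_simp
  · obtain ⟨k, rfl⟩ : ∃ k, n = 2 * k + 1 := by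
      rcases Nat.even_or_odd' n with ⟨k, rfl | rfl⟩
      · exact absurd ⟨k, rfl⟩ hn
      · exact ⟨k, rfl⟩
    rw [integral_integral_inner_pow_mul _ (hVc _)
      (fun v => integral_inner_sphere_pow_odd hd v k)]
    simp

end Radial

section NormLaw
variable {d : ℕ}

/-- The law of the norm under a continuous density, in polar coordinates. -/
lemma map_norm_withDensity (hd : 2 ≤ d) {g : Ed d → ℝ} (hgc : Continuous g)
    (hg0 : ∀ x, 0 ≤ g x) {μ : Measure (Ed d)} [IsFiniteMeasure μ]
    (hμ : μ = (volume : Measure (Ed d)).withDensity fun x => ENNReal.ofReal (g x))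
    {s : Set ℝ} (hs : MeasurableSet s) :
    μ.map (fun x : Ed d => ‖x‖) s =
      ENNReal.ofReal (∫ r in s ∩ Set.Ioi 0,
        r ^ (d - 1) * ∫ u : Sph d, g (r • (u : Ed d)) ∂(ωd d)) := by
  have hS : MeasurableSet ((fun x : Ed d => ‖x‖) ⁻¹' s) := measurable_norm hs
  have hgm : Measurable fun x => ENNReal.ofReal (g x) := hgc.measurable.ennreal_ofReal
  have hg2 : Continuous fun p : ℝ × Sph d => g (p.1 • (p.2 : Ed d)) := by fun_prop
  have hpos : ∀ r ∈ s ∩ Set.Ioi (0 : ℝ), ENNReal.ofReal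
      (r ^ (d - 1) * ∫ u : Sph d, g (r • (u : Ed d)) ∂(ωd d)) =
      ∫⁻ u : Sph d, ENNReal.ofReal (r ^ (d - 1)) *
        ENNReal.ofReal (g (r • (u : Ed d))) ∂(ωd d) := fun r hr => by
    have hr0 : (0 : ℝ) < r := hr.2
    have hc : Continuous fun u : Sph d => g (r • (u : Ed d)) := by fun_prop
    rw [ENNReal.ofReal_mul (by positivity), ofReal_integral_eq_lintegral_ofReal
      (hc.integrable_of_hasCompactSupport (HasCompactSupport.of_compactSpace _))
      (Eventually.of_forall fun u => hg0 _), lintegral_const_mul]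
    exact hc.measurable.ennreal_ofReal
  have hlin : μ.map (fun x : Ed d => ‖x‖) s = ∫⁻ r in s ∩ Set.Ioi 0,
      ENNReal.ofReal (r ^ (d - 1) * ∫ u : Sph d, g (r • (u : Ed d)) ∂(ωd d)) := by
    rw [Measure.map_apply measurable_norm hs, hμ, withDensity_apply _ hS,
      ← lintegral_indicator hS, lintegral_polar hd (hgm.indicator hS),
      setLIntegral_congr_fun (hs.inter measurableSet_Ioi) hpos, lintegral_lintegral_swap]
    · rw [← Measure.restrict_restrict hs, ← lintegral_indicator hs]
      refine setLIntegral_congr_fun measurableSet_Ioi fun r hr => ?_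
      have hn : ∀ u : Sph d, ‖r • (u : Ed d)‖ = r := fun u => by
        rw [norm_smul, norm_sphere, mul_one, Real.norm_of_nonneg (le_of_lt hr)]
      by_cases hrs : r ∈ s
      · simp [Set.indicator, hn, hrs]
      · simp [Set.indicator, hn, hrs]
    · have hm : Measurable fun p : Sph d × ℝ => p.2 • (p.1 : Ed d) := by fun_prop
      exact ((measurable_snd.pow_const _).ennreal_ofReal.mul
        ((hgm.indicator hS).comp hm)).aemeasurable
  have hmeas : AEStronglyMeasurable (fun r : ℝ =>
      r ^ (d - 1) * ∫ u : Sph d, g (r • (u : Ed d)) ∂(ωd d))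
      (volume.restrict (s ∩ Set.Ioi 0)) :=
    ((continuous_pow _).stronglyMeasurable.mul
      hg2.stronglyMeasurable.integral_prod_right).aestronglyMeasurable
  have hnn : 0 ≤ᵐ[volume.restrict (s ∩ Set.Ioi 0)] fun r : ℝ =>
      r ^ (d - 1) * ∫ u : Sph d, g (r • (u : Ed d)) ∂(ωd d) := by
    filter_upwards [ae_restrict_mem (hs.inter measurableSet_Ioi)] with r hr
    have hr0 : (0 : ℝ) < r := hr.2
    exact mul_nonneg (by positivity) (integral_nonneg fun u => hg0 _)
  rw [hlin, ofReal_integral_eq_lintegral_ofReal _ hnn]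
  refine ⟨hmeas, ?_⟩
  rw [hasFiniteIntegral_iff_ofReal hnn, ← hlin]
  exact measure_lt_top _ _

end NormLaw

/-- Proposition (density, `α ∈ (1,2)`): the everywhere-convergent series
`g(x) = (2^{1-d}/(π^{d/2}α)) Σ_n Γ((n+d)/α)(|x|/2)^n Σ_{m≤n/2}
(-1)^m S_{n-2m,-(n+d)/α}(u_x)/(m!Γ(n-m+d/2))`, uniformly absolutely convergent on
`{|x| ≤ M}`, together with the density of `|X|`. -/
theorem stmt14 (d : ℕ) (hd : 2 ≤ d) (α : ℝ) (hα1 : 1 < α) (hα2 : α < 2)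
    (Λ : Measure (Sph d)) [IsFiniteMeasure Λ] (hΛ : Λ ≠ 0)
    (μ : Measure (Ed d)) [IsProbabilityMeasure μ] (hμ : IsStableChar d α Λ μ)
    (hnd : Nondegenerate d μ)
    (g : Ed d → ℝ) (hg : IsDensityOf d α Λ g) :
    (∀ (x : Ed d) (u : Sph d), x = ‖x‖ • (u : Ed d) →
      (g x : ℂ) = (((2 : ℝ) ^ (1 - (d : ℝ)) / (Real.pi ^ ((d : ℝ) / 2) * α) : ℝ) : ℂ) *
        ∑' n : ℕ,
          ((Real.Gamma (((n : ℝ) + d) / α) * (‖x‖ / 2) ^ n : ℝ) : ℂ) *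
            ∑ m ∈ Finset.range (n / 2 + 1),
              (((-1 : ℝ) ^ m / ((Nat.factorial m : ℝ) *
                  Real.Gamma ((n : ℝ) - m + (d : ℝ) / 2)) : ℝ) : ℂ) *
                SHp d α Λ (n - 2 * m) (-(((n : ℝ) + d) / α)) u) ∧
    (∀ M : ℝ, 0 < M → ∃ c : ℕ → ℝ, Summable c ∧
      ∀ (n : ℕ) (x : Ed d) (u : Sph d), x = ‖x‖ • (u : Ed d) → ‖x‖ ≤ M →
        ∑ m ∈ Finset.range (n / 2 + 1),
          ‖((Real.Gamma (((n : ℝ) + d) / α) * (‖x‖ / 2) ^ n : ℝ) : ℂ) *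
            ((((-1 : ℝ) ^ m / ((Nat.factorial m : ℝ) *
                Real.Gamma ((n : ℝ) - m + (d : ℝ) / 2)) : ℝ) : ℂ) *
              SHp d α Λ (n - 2 * m) (-(((n : ℝ) + d) / α)) u)‖ ≤ c n) ∧
    (∀ r : ℝ, 0 < r →
      (∑' n : ℕ,
        (((1 / (Real.pi ^ ((d : ℝ) / 2) * α)) * ((-1 : ℝ) ^ n *
            Real.Gamma ((2 * (n : ℝ) + d) / α) /
            ((Nat.factorial n : ℝ) * Real.Gamma ((n : ℝ) + (d : ℝ) / 2))) *
          (r / 2) ^ (2 * n + d - 1) : ℝ) : ℂ) *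
          ∫ u, (Vfun d α Λ u) ^ ((-((2 * (n : ℝ) + d) / α) : ℝ) : ℂ) ∂(ωd d)).im = 0) ∧
    ∀ s : Set ℝ, MeasurableSet s →
      μ.map (fun x : Ed d => ‖x‖) s =
        ENNReal.ofReal (∫ r in s ∩ Set.Ioi 0,
          (∑' n : ℕ,
            (((1 / (Real.pi ^ ((d : ℝ) / 2) * α)) * ((-1 : ℝ) ^ n *
                Real.Gamma ((2 * (n : ℝ) + d) / α) /
                ((Nat.factorial n : ℝ) * Real.Gamma ((n : ℝ) + (d : ℝ) / 2))) *
              (r / 2) ^ (2 * n + d - 1) : ℝ) : ℂ) *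
              ∫ u, (Vfun d α Λ u) ^ ((-((2 * (n : ℝ) + d) / α) : ℝ) : ℂ) ∂(ωd d)).re) := by
  have hα0 : 0 < α := by linarith
  obtain ⟨c, hc0, hc⟩ := exists_le_Vfun_re hα0 hμ hnd
  have hr : ∀ r : ℝ, 0 < r → _ := fun r hr => (hasSum_radial_density hd hα1 hc0 hc hg hr).tsum_eq
  refine ⟨fun x u hx => ?_, fun M hM => ?_, fun r hr0 => ?_, fun s hs => ?_⟩
  · rw [← tsum_mul_left]
    exact (hasSum_density_zonal hd hα1 hc0 hc hg x u hx).tsum_eq.symm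
  · obtain ⟨b, hb, hle⟩ := exists_summable_bound hd hα1 hc0 hc hM
    exact ⟨b, hb, fun n x u _ hx => hle n x u hx⟩
  · rw [hr r hr0, Complex.ofReal_im]
  · rw [map_norm_withDensity hd (hg.continuous hd hα0 hc0 hc)
      (density_nonneg hd hα0 hc0 hc hg hμ) (eq_withDensity_density hd hα0 hc0 hc hg hμ) hs]
    congr 1
    refine setIntegral_congr_fun (hs.inter measurableSet_Ioi) fun r hrs => ?_
    simp only [hr r hrs.2, Complex.ofReal_re]

end StablePaper
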